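/- Let S be a closed subset of ℝⁿ (n > 1) containing a point x such that some neighborhood of x in S is homeomorphic to an open subset of ℝ^{n-1}. Then there exist open balls B₂ ⊂ B₁ centered at x such that every connected component C of B₁ \ S either is disjoint from B₂, or satisfies B₂ ∩ S ⊆ closure(C); moreover exactly two connected components of B₁ \ S satisfy the latter condition. -/

import Mathlib

/-- The set of connected components of `B₁ \ S` that satisfy condition (2), i.e. contain
`B₂ ∩ S` in their closure. -/
def sepComponents {α : Type*} [TopologicalSpace α] (S B₁ B₂ : Set α) : Set (Set α) :=
  {C | (∃ z ∈ B₁ \ S, C = connectedComponentIn (B₁ \ S) z) ∧ B₂ ∩ S ⊆ closure C}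


namespace LJB
open Filter Topology

/-- Mod 2 cubical (possibly infinite) chains of all dimensions on the cubical grid, with doubled
coordinates: an even coordinate denotes a vertex, an odd one an edge. -/
abbrev Ch (n : ℕ) := (Fin n → ℤ) → ZMod 2

variable {n : ℕ}

theorem ch_add_self (c : Ch n) : c + c = 0 := by
  funext a; exact CharTwo.add_self_eq_zero _

/-- partial boundary in direction `i` -/
def D (i : Fin n) : Ch n →ₗ[ZMod 2] Ch n where
  toFun c a := if Even (a i) then
    c (Function.update a i (a i + 1)) + c (Function.update a i (a i - 1)) else 0
  map_add' c d := by
    funext a; simp only [Pi.add_apply]; split_ifs <;> ring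
  map_smul' r c := by
    funext a; simp only [Pi.smul_apply, RingHom.id_apply, smul_eq_mul]; split_ifs <;> ring

theorem D_apply (i : Fin n) (c : Ch n) (a) : D i c a = if Even (a i) then
    c (Function.update a i (a i + 1)) + c (Function.update a i (a i - 1)) else 0 := rfl

theorem D_D (i : Fin n) (c : Ch n) : D i (D i c) = 0 := by
  funext a
  simp only [D_apply, Function.update_self, Function.update_idem, Pi.zero_apply]
  by_cases h : Even (a i)
  · have h1 : ¬ Even (a i + 1) := by simpa [Int.even_add_one] using h
    have h2 : ¬ Even (a i - 1) := by simpa [Int.even_sub_one] using h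
    simp [h, h1, h2]
  · simp [h]

theorem D_comm (i j : Fin n) (c : Ch n) : D i (D j c) = D j (D i c) := by
  by_cases hij : i = j
  · rw [hij]
  funext a
  have hji : j ≠ i := fun h => hij h.symm
  simp only [D_apply, Function.update_of_ne hji, Function.update_of_ne hij]
  by_cases h : Even (a i) <;> by_cases h' : Even (a j) <;> simp only [h, h', if_true, if_false]
  · simp only [Function.update_comm hij]
    ring
  · simp
  · simp

/-- total boundary -/
def bd : Ch n →ₗ[ZMod 2] Ch n := ∑ i, D i

theorem bd_eq (c : Ch n) : bd c = ∑ i, D i c := by simp [bd]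

theorem bd_apply (c : Ch n) (a) : bd c a = ∑ i, D i c a := by simp [bd]

theorem bd_bd (c : Ch n) : bd (bd c) = 0 := by
  have key : ∀ s : Finset (Fin n), ∑ i ∈ s, D i (∑ j ∈ s, D j c) = 0 := by
    intro s
    induction s using Finset.induction_on with
    | empty => simp
    | insert i s hi ih =>
      rw [Finset.sum_insert hi, Finset.sum_insert hi]
      simp only [map_add, D_D, zero_add, Finset.sum_add_distrib, ih, add_zero]
      rw [map_sum]
      simp only [D_comm i]
      exact ch_add_self _
  rw [bd_eq, bd_eq]; exact key _

def par (b : ℤ) : ℤ := 2 * (b / 4) + b % 2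

/-- subdivision -/
def sd : Ch n →ₗ[ZMod 2] Ch n where
  toFun c b := if ∀ i, b i % 4 ≠ 2 then c (fun i => par (b i)) else 0
  map_add' c d := by
    funext a; simp only [Pi.add_apply]; split_ifs <;> ring
  map_smul' r c := by
    funext a; simp only [Pi.smul_apply, RingHom.id_apply, smul_eq_mul]; split_ifs <;> ring

theorem sd_apply (c : Ch n) (b) :
    sd c b = if ∀ i, b i % 4 ≠ 2 then c (fun i => par (b i)) else 0 := rfl

theorem par_update (b : Fin n → ℤ) (i : Fin n) (v : ℤ) :
    (fun j => par (Function.update b i v j)) = Function.update (fun j => par (b j)) i (par v) := by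
  funext j
  by_cases h : j = i
  · subst h; simp
  · simp [h]

theorem D_sd (i : Fin n) (c : Ch n) : D i (sd c) = sd (D i c) := by
  funext b
  simp only [D_apply, sd_apply, par_update]
  by_cases hb : ∀ j, j ≠ i → b j % 4 ≠ 2
  · have hu : ∀ v : ℤ, (∀ j, Function.update b i v j % 4 ≠ 2) ↔ v % 4 ≠ 2 := by
      intro v
      constructor
      · intro h; simpa using h i
      · intro h j
        by_cases hj : j = i
        · subst hj; simpa using h
        · simpa [hj] using hb j hj
    have hu0 : (∀ j, b j % 4 ≠ 2) ↔ b i % 4 ≠ 2 := by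
      have := hu (b i); rwa [Function.update_eq_self] at this
    simp only [hu, hu0]
    have hmod : b i % 4 = 0 ∨ b i % 4 = 1 ∨ b i % 4 = 2 ∨ b i % 4 = 3 := by omega
    rcases hmod with h | h | h | h
    · have e1 : Even (b i) := by rw [Int.even_iff]; omega
      have e2 : Even (par (b i)) := by rw [Int.even_iff]; unfold par; omega
      have e3 : (b i + 1) % 4 ≠ 2 := by omega
      have e4 : (b i - 1) % 4 ≠ 2 := by omega
      have e5 : par (b i + 1) = par (b i) + 1 := by unfold par; omega
      have e6 : par (b i - 1) = par (b i) - 1 := by unfold par; omega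
      have e7 : b i % 4 ≠ 2 := by omega
      simp only [e1, e2, e3, e4, e5, e6, e7, if_true, not_false_eq_true, ne_eq]
    · have e1 : ¬ Even (b i) := by rw [Int.even_iff]; omega
      have e2 : ¬ Even (par (b i)) := by rw [Int.even_iff]; unfold par; omega
      simp [e1, e2]
    · have e1 : Even (b i) := by rw [Int.even_iff]; omega
      have e3 : (b i + 1) % 4 ≠ 2 := by omega
      have e4 : (b i - 1) % 4 ≠ 2 := by omega
      have e5 : par (b i + 1) = par (b i - 1) := by unfold par; omega
      have e7 : ¬ (b i % 4 ≠ 2) := by omega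
      simp only [e1, e3, e4, e5, e7, if_true, not_false_eq_true, ne_eq, if_false]
      exact CharTwo.add_self_eq_zero _
    · have e1 : ¬ Even (b i) := by rw [Int.even_iff]; omega
      have e2 : ¬ Even (par (b i)) := by rw [Int.even_iff]; unfold par; omega
      simp [e1, e2]
  · push Not at hb
    obtain ⟨j, hj, hb⟩ := hb
    have hu : ∀ v : ℤ, ¬ (∀ j, Function.update b i v j % 4 ≠ 2) := by
      intro v h; exact h j (by simpa [hj] using hb)
    have hu0 : ¬ (∀ j, b j % 4 ≠ 2) := fun h => h j hb
    simp only [hu, hu0, if_false]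
    simp

theorem bd_sd (c : Ch n) : bd (sd c) = sd (bd c) := by
  rw [bd_eq, bd_eq, map_sum]; simp only [D_sd]

/-- closed cell of the grid of mesh `2 ^ (-N)` -/
def cell (N : ℕ) (a : Fin n → ℤ) : Set (Fin n → ℝ) :=
  {x | ∀ i, ((a i / 2 : ℤ) : ℝ) ≤ x i * 2 ^ N ∧ x i * 2 ^ N ≤ (((a i + 1) / 2 : ℤ) : ℝ)}

theorem cell_par (N : ℕ) (b : Fin n → ℤ) (hb : ∀ i, b i % 4 ≠ 2) :
    cell (N + 1) b ⊆ cell N (fun i => par (b i)) := by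
  intro x hx i
  have h := hx i
  have hbi := hb i
  have h1 : 2 * (par (b i) / 2) ≤ b i / 2 := by unfold par; omega
  have h2 : (b i + 1) / 2 ≤ 2 * ((par (b i) + 1) / 2) := by unfold par; omega
  have h1' : 2 * ((par (b i) / 2 : ℤ) : ℝ) ≤ ((b i / 2 : ℤ) : ℝ) := by exact_mod_cast h1
  have h2' : (((b i + 1) / 2 : ℤ) : ℝ) ≤ 2 * (((par (b i) + 1) / 2 : ℤ) : ℝ) := by exact_mod_cast h2
  rw [pow_succ] at h
  constructor <;> nlinarith [h.1, h.2]

theorem cell_update (N : ℕ) (a : Fin n → ℤ) (i : Fin n) (hi : Even (a i)) (v : ℤ)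
    (hv : v = a i + 1 ∨ v = a i - 1) : cell N a ⊆ cell N (Function.update a i v) := by
  intro x hx j
  by_cases h : j = i
  · subst h
    have := hx j
    rw [Int.even_iff] at hi
    simp only [Function.update_self]
    have h1 : v / 2 ≤ a j / 2 := by omega
    have h2 : (a j + 1) / 2 ≤ (v + 1) / 2 := by omega
    have h1' : ((v / 2 : ℤ) : ℝ) ≤ ((a j / 2 : ℤ) : ℝ) := by exact_mod_cast h1
    have h2' : (((a j + 1) / 2 : ℤ) : ℝ) ≤ (((v + 1) / 2 : ℤ) : ℝ) := by exact_mod_cast h2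
    exact ⟨by linarith, by linarith⟩
  · simpa [h] using hx j

theorem cell_eq_Icc (N : ℕ) (a : Fin n → ℤ) : cell N a =
    Set.Icc (fun i => ((a i / 2 : ℤ) : ℝ) / 2 ^ N) (fun i => (((a i + 1) / 2 : ℤ) : ℝ) / 2 ^ N) := by
  ext x
  have h2 : (0 : ℝ) < 2 ^ N := by positivity
  simp only [cell, Set.mem_ofPred_eq, Set.mem_Icc, Pi.le_def, div_le_iff₀ h2, le_div_iff₀ h2]
  exact forall_and

theorem cell_compact (N : ℕ) (a : Fin n → ℤ) : IsCompact (cell N a) := by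
  rw [cell_eq_Icc]; exact isCompact_Icc

theorem cell_convex (N : ℕ) (a : Fin n → ℤ) : Convex ℝ (cell N a) := by
  rw [cell_eq_Icc]; exact convex_Icc _ _

theorem cell_nonempty (N : ℕ) (a : Fin n → ℤ) : (cell N a).Nonempty := by
  rw [cell_eq_Icc, Set.nonempty_Icc]
  intro i
  have : a i / 2 ≤ (a i + 1) / 2 := by omega
  have : ((a i / 2 : ℤ) : ℝ) ≤ (((a i + 1) / 2 : ℤ) : ℝ) := by exact_mod_cast this
  simp only
  gcongr

theorem cell_dist (N : ℕ) (a : Fin n → ℤ) {x y} (hx : x ∈ cell N a) (hy : y ∈ cell N a) :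
    dist x y ≤ 1 / 2 ^ N := by
  rw [dist_pi_le_iff (by positivity)]
  intro i
  have h2 : (0 : ℝ) < 2 ^ N := by positivity
  have h : (a i + 1) / 2 ≤ a i / 2 + 1 := by omega
  have h' : (((a i + 1) / 2 : ℤ) : ℝ) ≤ ((a i / 2 : ℤ) : ℝ) + 1 := by exact_mod_cast h
  rw [Real.dist_eq, abs_le, ← neg_div, div_le_iff₀ h2, le_div_iff₀ h2]
  have := hx i
  have := hy i
  constructor <;> nlinarith

theorem cells_finite (N : ℕ) (B : Set (Fin n → ℝ)) (hB : Bornology.IsBounded B) :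
    {a : Fin n → ℤ | (cell N a ∩ B).Nonempty}.Finite := by
  obtain ⟨R, hR⟩ := hB.subset_closedBall 0
  obtain ⟨k, hk⟩ := exists_nat_gt (R * 2 ^ N)
  apply (Set.finite_Icc (fun _ : Fin n => (-(2 * k + 2) : ℤ)) (fun _ => (2 * k + 2 : ℤ))).subset
  rintro a ⟨x, hx, hxB⟩
  have hxR := hR hxB
  rw [mem_closedBall_zero_iff] at hxR
  have h2 : (0 : ℝ) < 2 ^ N := by positivity
  have : ∀ i, -((2 * k + 2 : ℤ)) ≤ a i ∧ a i ≤ 2 * k + 2 := by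
    intro i
    have h1 := (norm_le_pi_norm x i).trans hxR
    rw [Real.norm_eq_abs, abs_le] at h1
    have h3 := hx i
    have h4 : ((a i / 2 : ℤ) : ℝ) < (k : ℤ) := by push_cast; nlinarith
    have h5 : ((-k : ℤ) : ℝ) < (((a i + 1) / 2 : ℤ) : ℝ) := by push_cast; nlinarith
    have h4' : a i / 2 < k := by exact_mod_cast h4
    have h5' : -(k:ℤ) < (a i + 1) / 2 := by exact_mod_cast h5
    constructor <;> omega
  exact ⟨fun i => (this i).1, fun i => (this i).2⟩

/-- support of a chain -/
def supp (N : ℕ) (c : Ch n) : Set (Fin n → ℝ) := ⋃ a : {a // c a ≠ 0}, cell N a.1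

theorem supp_closed (N : ℕ) (c : Ch n) : IsClosed (supp N c) := by
  apply LocallyFinite.isClosed_iUnion
  · intro x
    refine ⟨Metric.ball x 1, Metric.ball_mem_nhds _ one_pos, ?_⟩
    have h := (cells_finite (n := n) N (Metric.ball x 1) Metric.isBounded_ball).preimage
      (f := (Subtype.val : {a // c a ≠ 0} → _)) Subtype.val_injective.injOn
    exact h
  · intro a; exact (cell_compact N a.1).isClosed

/-- the chain `c` of level `N` avoids `K` -/
def Avoids (N : ℕ) (c : Ch n) (K : Set (Fin n → ℝ)) : Prop := ∀ a, c a ≠ 0 → Disjoint (cell N a) K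

theorem avoids_iff (N : ℕ) (c : Ch n) (K) : Avoids N c K ↔ Disjoint (supp N c) K := by
  simp [Avoids, supp, Set.disjoint_iUnion_left]

theorem Avoids.mono {N : ℕ} {c : Ch n} {K L} (h : Avoids N c K) (hL : L ⊆ K) : Avoids N c L :=
  fun a ha => (h a ha).mono_right hL

theorem Avoids.add {N : ℕ} {c d : Ch n} {K} (h : Avoids N c K) (h' : Avoids N d K) :
    Avoids N (c + d) K := by
  intro a ha
  by_cases h0 : c a = 0
  · apply h' a; simpa [h0] using ha
  · exact h a h0

theorem Avoids.union {N : ℕ} {c : Ch n} {K L} (h : Avoids N c K) (h' : Avoids N c L) :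
    Avoids N c (K ∪ L) := fun a ha => Set.disjoint_union_right.2 ⟨h a ha, h' a ha⟩

theorem Avoids.sd {N : ℕ} {c : Ch n} {K} (h : Avoids N c K) : Avoids (N + 1) (sd c) K := by
  intro b hb
  rw [sd_apply] at hb
  split_ifs at hb with h1
  · exact (h _ hb).mono_left (cell_par N b h1)
  · exact absurd rfl hb

theorem Avoids.bd {N : ℕ} {c : Ch n} {K} (h : Avoids N c K) : Avoids N (bd c) K := by
  intro a ha
  rw [bd_apply] at ha
  obtain ⟨i, -, hi⟩ := Finset.exists_ne_zero_of_sum_ne_zero ha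
  rw [D_apply] at hi
  split_ifs at hi with he
  · by_cases h0 : c (Function.update a i (a i + 1)) = 0
    · rw [h0, zero_add] at hi
      exact (h _ hi).mono_left (cell_update N a i he _ (Or.inr rfl))
    · exact (h _ h0).mono_left (cell_update N a i he _ (Or.inl rfl))
  · exact absurd rfl hi

/-- restriction of a chain to a set of cells -/
noncomputable def rs (P : (Fin n → ℤ) → Prop) (c : Ch n) : Ch n := by
  classical exact fun a => if P a then c a else 0

theorem rs_apply_pos {P : (Fin n → ℤ) → Prop} {c : Ch n} {a} (h : P a) : rs P c a = c a := by
  simp [rs, h]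

theorem rs_apply_neg {P : (Fin n → ℤ) → Prop} {c : Ch n} {a} (h : ¬ P a) : rs P c a = 0 := by
  simp [rs, h]

theorem rs_ne {P : (Fin n → ℤ) → Prop} {c : Ch n} {a} (h : rs P c a ≠ 0) : P a ∧ c a ≠ 0 := by
  by_cases hP : P a
  · rw [rs_apply_pos hP] at h; exact ⟨hP, h⟩
  · exact absurd (rs_apply_neg hP) h

theorem rs_add_not (P : (Fin n → ℤ) → Prop) (c : Ch n) : c = rs P c + rs (fun a => ¬ P a) c := by
  funext a
  by_cases h : P a
  · simp [rs, h]
  · simp [rs, h]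

theorem Avoids.rs {N : ℕ} {c : Ch n} {K} (P) (h : Avoids N c K) : Avoids N (rs P c) K :=
  fun a ha => h a (rs_ne ha).2

/-- homogeneous of dimension `d` -/
def Hm (d : ℕ) (c : Ch n) : Prop := ∀ a, c a ≠ 0 → (Finset.univ.filter fun i => Odd (a i)).card = d

theorem Hm.sd {d : ℕ} {c : Ch n} (h : Hm d c) : Hm d (sd c) := by
  intro b hb
  rw [sd_apply] at hb
  split_ifs at hb with h1
  · rw [← h _ hb]
    congr 1
    ext i
    simp only [Finset.mem_filter, Finset.mem_univ, true_and, Int.odd_iff]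
    unfold par; omega
  · exact absurd rfl hb

theorem Hm.rs {d : ℕ} {c : Ch n} (P) (h : Hm d c) : Hm d (rs P c) := fun a ha => h a (rs_ne ha).2

theorem Hm.bd {d : ℕ} {c : Ch n} (h : Hm (d + 1) c) : Hm d (bd c) := by
  intro a ha
  rw [bd_apply] at ha
  obtain ⟨i, -, hi⟩ := Finset.exists_ne_zero_of_sum_ne_zero ha
  rw [D_apply] at hi
  split_ifs at hi with he
  · have key : ∀ v : ℤ, Odd v → c (Function.update a i v) ≠ 0 →
        (Finset.univ.filter fun i => Odd (a i)).card = d := by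
      intro v hv hc
      have h1 := h _ hc
      have h2 : (Finset.univ.filter fun j => Odd (Function.update a i v j)) =
          insert i (Finset.univ.filter fun i => Odd (a i)) := by
        ext j
        by_cases hj : j = i
        · subst hj; simp [hv]
        · simp [hj]
      rw [h2, Finset.card_insert_of_notMem (by simpa using he)] at h1
      omega
    by_cases h0 : c (Function.update a i (a i + 1)) = 0
    · rw [h0, zero_add] at hi
      exact key _ (he.sub_odd odd_one) hi
    · exact key _ he.add_one h0
  · exact absurd rfl hi

end LJB


namespace LJB
open Filter Topology

variable {n : ℕ}

/-! Homotopy operators -/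

def hop (i : Fin n) (J : ℤ → Finset ℤ) : Ch n →ₗ[ZMod 2] Ch n where
  toFun c a := if Odd (a i) then ∑ v ∈ J (a i), c (Function.update a i v) else 0
  map_add' c d := by
    funext a; simp only [Pi.add_apply]; split_ifs
    · exact Finset.sum_add_distrib
    · simp
  map_smul' r c := by
    funext a; simp only [Pi.smul_apply, RingHom.id_apply, smul_eq_mul]; split_ifs
    · rw [Finset.mul_sum]
    · simp

theorem hop_apply (i : Fin n) (J) (c : Ch n) (a) : hop i J c a =
    if Odd (a i) then ∑ v ∈ J (a i), c (Function.update a i v) else 0 := rfl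

theorem D_hop {i j : Fin n} (hij : j ≠ i) (J) (c : Ch n) : D j (hop i J c) = hop i J (D j c) := by
  funext a
  have hji : i ≠ j := fun h => hij h.symm
  simp only [D_apply, hop_apply, Function.update_of_ne hij, Function.update_of_ne hji]
  by_cases h : Odd (a i) <;> by_cases h' : Even (a j) <;> simp only [h, h', if_true, if_false]
  · rw [← Finset.sum_add_distrib]
    apply Finset.sum_congr rfl
    intro v _
    rw [Function.update_comm hij, Function.update_comm hij]
  · simp
  · simp

theorem bd_hop (i : Fin n) (J) (c : Ch n) (hc : bd c = 0) :
    bd (hop i J c) = D i (hop i J c) + hop i J (D i c) := by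
  have h1 : bd (hop i J c) = D i (hop i J c) + ∑ j ∈ Finset.univ.erase i, hop i J (D j c) := by
    rw [bd_eq, ← Finset.add_sum_erase _ _ (Finset.mem_univ i)]
    congr 1
    apply Finset.sum_congr rfl
    intro j hj
    exact D_hop (Finset.ne_of_mem_erase hj) J c
  have h2 : hop i J (D i c) + ∑ j ∈ Finset.univ.erase i, hop i J (D j c) = 0 := by
    rw [Finset.add_sum_erase _ (fun j => hop i J (D j c)) (Finset.mem_univ i), ← map_sum, ← bd_eq, hc, map_zero]
  rw [h1]
  congr 1
  have h3 := ch_add_self (hop i J (D i c))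
  rw [← h2] at h3
  exact (add_left_cancel h3).symm

noncomputable def evI (o a : ℤ) : Finset ℤ := (Finset.Ioo o a).filter Even

theorem evI_right {o a : ℤ} (ha : Even a) (h : o < a) : evI o (a + 1) = insert a (evI o (a - 1)) := by
  ext v; simp only [evI, Finset.mem_filter, Finset.mem_Ioo, Finset.mem_insert, Int.even_iff] at *; omega

theorem evI_left {o a : ℤ} (ha : Even a) (h : a < o) : evI (a - 1) o = insert a (evI (a + 1) o) := by
  ext v; simp only [evI, Finset.mem_filter, Finset.mem_Ioo, Finset.mem_insert, Int.even_iff] at *; omega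

theorem evI_empty {o a : ℤ} (h : a ≤ o + 1) : evI o a = ∅ := by
  ext v; simp only [evI, Finset.mem_filter, Finset.mem_Ioo, Finset.notMem_empty, iff_false]; omega

theorem zm_cancel (x y z : ZMod 2) : x + y + (z + x) = z + y := by
  revert x y z; decide

theorem tele_right (f : ℤ → ZMod 2) {o : ℤ} (ho : Even o) {a : ℤ} (ha : Odd a) (h : o < a) :
    ∑ v ∈ evI o a, (f (v + 1) + f (v - 1)) = f a + f (o + 1) := by
  obtain ⟨t, ht⟩ : ∃ t : ℕ, a = o + 2 * t + 1 := by
    refine ⟨((a - o) / 2).toNat, ?_⟩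
    rw [Int.odd_iff] at ha; rw [Int.even_iff] at ho
    omega
  subst ht
  clear ha h
  induction t with
  | zero =>
    rw [evI_empty (by push_cast; omega)]; simp only [Finset.sum_empty]
    push_cast; rw [add_zero]; exact (CharTwo.add_self_eq_zero _).symm
  | succ t ih =>
    have h1 : o + 2 * ((t + 1 : ℕ) : ℤ) + 1 = (o + 2 * t + 2) + 1 := by push_cast; ring
    have h2 : (o + 2 * t + 2) - 1 = o + 2 * (t : ℤ) + 1 := by ring
    have h3 : Even (o + 2 * (t : ℤ) + 2) := by rw [Int.even_iff] at *; omega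
    rw [h1, evI_right h3 (by omega), Finset.sum_insert (by simp [evI]), h2, ih]
    generalize f (o + 1) = x
    generalize f (o + 2 * (t : ℤ) + 1) = y
    generalize f (o + 2 * (t : ℤ) + 2 + 1) = z
    revert x y z; decide

theorem tele_left (f : ℤ → ZMod 2) {o : ℤ} (ho : Even o) {a : ℤ} (ha : Odd a) (h : a < o) :
    ∑ v ∈ evI a o, (f (v + 1) + f (v - 1)) = f a + f (o - 1) := by
  obtain ⟨t, ht⟩ : ∃ t : ℕ, a = o - 2 * t - 1 := by
    refine ⟨((o - a) / 2).toNat, ?_⟩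
    rw [Int.odd_iff] at ha; rw [Int.even_iff] at ho
    omega
  subst ht
  clear ha h
  induction t with
  | zero =>
    rw [evI_empty (by push_cast; omega)]; simp only [Finset.sum_empty]
    push_cast; rw [sub_zero]; exact (CharTwo.add_self_eq_zero _).symm
  | succ t ih =>
    have h1 : o - 2 * ((t + 1 : ℕ) : ℤ) - 1 = (o - 2 * t - 2) - 1 := by push_cast; ring
    have h2 : (o - 2 * t - 2) + 1 = o - 2 * (t : ℤ) - 1 := by ring
    have h3 : Even (o - 2 * (t : ℤ) - 2) := by rw [Int.even_iff] at *; omega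
    rw [h1, evI_left h3 (by omega), Finset.sum_insert (by simp [evI]), h2, ih]
    generalize f (o - 1) = x
    generalize f (o - 2 * (t : ℤ) - 1) = y
    generalize f (o - 2 * (t : ℤ) - 2 - 1) = z
    revert x y z; decide

/-- value of `D i ∘ hop + hop ∘ D i` at an odd coordinate -/
theorem hcomb_odd (i : Fin n) (J) (c : Ch n) (a : Fin n → ℤ) (ha : Odd (a i))
    (hJ : ∀ v ∈ J (a i), Even v) : (D i (hop i J c) + hop i J (D i c)) a =
    ∑ v ∈ J (a i), (c (Function.update a i (v + 1)) + c (Function.update a i (v - 1))) := by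
  have he : ¬ Even (a i) := by simpa using ha
  simp only [Pi.add_apply, D_apply, hop_apply, he, ha, if_false, if_true, zero_add]
  apply Finset.sum_congr rfl
  intro v hv
  simp [hJ v hv]

theorem hcomb_even (i : Fin n) (J) (c : Ch n) (a : Fin n → ℤ) (ha : Even (a i)) :
    (D i (hop i J c) + hop i J (D i c)) a =
    ∑ v ∈ J (a i + 1), c (Function.update a i v) + ∑ v ∈ J (a i - 1), c (Function.update a i v) := by
  have he : ¬ Odd (a i) := by simpa using ha
  have h1 : Odd (a i + 1) := ha.add_one
  have h2 : Odd (a i - 1) := ha.sub_odd odd_one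
  simp only [Pi.add_apply, D_apply, hop_apply, he, ha, if_false, if_true, add_zero,
    Function.update_self, h1, h2, Function.update_idem]

noncomputable def Jp (o a : ℤ) : Finset ℤ := if o < a then evI o a else evI a o

theorem Jp_even {o a v : ℤ} (h : v ∈ Jp o a) : Even v := by
  unfold Jp evI at h; split_ifs at h <;> exact (Finset.mem_filter.1 h).2

theorem push_out (i : Fin n) (o : ℤ) (ho : Even o) (c : Ch n) (hc : bd c = 0) (a : Fin n → ℤ) :
    (c + bd (hop i (Jp o) c)) a = 0 ∨ ∃ v, |v - o| ≤ 1 ∧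
      (c + bd (hop i (Jp o) c)) a = c (Function.update a i v) := by
  rw [bd_hop i _ c hc, Pi.add_apply]
  rcases Int.even_or_odd (a i) with ha | ha
  · rw [hcomb_even i _ c a ha]
    rcases lt_trichotomy (a i) o with h | h | h
    · left
      have h1 : Jp o (a i - 1) = insert (a i) (Jp o (a i + 1)) := by
        unfold Jp
        rw [if_neg (by omega), if_neg (by rw [Int.even_iff] at *; omega), evI_left ha h]
      have h2 : a i ∉ Jp o (a i + 1) := by
        unfold Jp evI; rw [if_neg (by rw [Int.even_iff] at *; omega)]; simp
      rw [h1, Finset.sum_insert h2, Function.update_eq_self]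
      generalize c a = x
      generalize ∑ v ∈ Jp o (a i + 1), c (Function.update a i v) = y
      revert x y; decide
    · right
      refine ⟨o, by simp, ?_⟩
      have h1 : Jp o (a i + 1) = ∅ := by
        unfold Jp; rw [if_pos (by omega)]; exact evI_empty (by omega)
      have h2 : Jp o (a i - 1) = ∅ := by
        unfold Jp; rw [if_neg (by omega)]; exact evI_empty (by omega)
      rw [h1, h2, ← h]
      simp
    · left
      have h1 : Jp o (a i + 1) = insert (a i) (Jp o (a i - 1)) := by
        unfold Jp
        rw [if_pos (by omega), if_pos (by rw [Int.even_iff] at *; omega), evI_right ha h]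
      have h2 : a i ∉ Jp o (a i - 1) := by
        unfold Jp evI; rw [if_pos (by rw [Int.even_iff] at *; omega)]; simp
      rw [h1, Finset.sum_insert h2, Function.update_eq_self]
      generalize c a = x
      generalize ∑ v ∈ Jp o (a i - 1), c (Function.update a i v) = y
      revert x y; decide
  · rw [hcomb_odd i _ c a ha (fun v hv => Jp_even hv)]
    right
    have hne : a i ≠ o := by rintro h; rw [h] at ha; exact (Int.not_even_iff_odd.2 ha) ho
    rcases lt_or_gt_of_ne hne with h | h
    · refine ⟨o - 1, by norm_num, ?_⟩
      unfold Jp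
      rw [if_neg (by omega), tele_left (fun v => c (Function.update a i v)) ho ha h]
      simp only [Function.update_eq_self]
      rw [← add_assoc, CharTwo.add_self_eq_zero, zero_add]
    · refine ⟨o + 1, by norm_num, ?_⟩
      unfold Jp
      rw [if_pos (by omega), tele_right (fun v => c (Function.update a i v)) ho ha h]
      simp only [Function.update_eq_self]
      rw [← add_assoc, CharTwo.add_self_eq_zero, zero_add]

/-- If a cycle vanishes on the block of cells around the vertex `o`, then it is the boundary
of a chain living on cells some coordinate of which is far from that of `o`. -/
theorem push_all (o : Fin n → ℤ) (ho : ∀ i, Even (o i)) (c : Ch n) (hc : bd c = 0)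
    (hv : ∀ a, (∀ i, |a i - o i| ≤ 1) → c a = 0) :
    ∃ e : Ch n, bd e = c ∧ ∀ a, e a ≠ 0 → ∃ i, 3 ≤ |a i - o i| := by
  have key : ∀ s : Finset (Fin n), ∃ e : Ch n, (∀ a, e a ≠ 0 → ∃ i, 3 ≤ |a i - o i|) ∧
      ∀ a, (∀ i, i ∉ s → |a i - o i| ≤ 1) → (c + bd e) a = 0 := by
    intro s
    induction s using Finset.induction_on with
    | empty =>
      refine ⟨0, by simp, ?_⟩
      intro a ha
      rw [map_zero, add_zero]
      exact hv a (fun i => ha i (by simp))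
    | insert i s hi ih =>
      obtain ⟨e, he, hz⟩ := ih
      have hc' : bd (c + bd e) = 0 := by rw [map_add, hc, bd_bd, zero_add]
      refine ⟨e + hop i (Jp (o i)) (c + bd e), ?_, ?_⟩
      · intro a ha
        by_cases h0 : e a = 0
        · rw [Pi.add_apply, h0, zero_add, hop_apply] at ha
          split_ifs at ha with hodd
          · refine ⟨i, ?_⟩
            obtain ⟨v, hvJ, -⟩ := Finset.exists_ne_zero_of_sum_ne_zero ha
            have hoi := ho i
            unfold Jp at hvJ
            unfold evI at hvJ
            rw [Int.even_iff] at hoi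
            rw [Int.odd_iff] at hodd
            split_ifs at hvJ
            all_goals
              simp only [Finset.mem_filter, Finset.mem_Ioo, Int.even_iff] at hvJ
              rw [le_abs]
              omega
          · exact absurd rfl ha
        · exact he a h0
      · intro a ha
        rw [map_add, ← add_assoc]
        rcases push_out i (o i) (ho i) (c + bd e) hc' a with h | ⟨v, hv1, h⟩
        · exact h
        · rw [h]
          apply hz
          intro j hj
          by_cases hji : j = i
          · subst hji; simpa using hv1
          · rw [Function.update_of_ne hji]
            exact ha j (by simp [hji, hj])
  obtain ⟨e, he, hz⟩ := key Finset.univ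
  refine ⟨e, ?_, he⟩
  have : c + bd e = 0 := by
    funext a; exact hz a (fun i hi => absurd (Finset.mem_univ i) hi)
  have h2 := ch_add_self c
  rw [← this] at h2
  exact (add_left_cancel h2).symm

/-! Boxes -/

noncomputable def Jb (L M a : ℤ) : Finset ℤ := if a < M then evI (L - 2) a else ∅

theorem push_box (i : Fin n) (L M : ℤ) (hL : Even L) (hM : Even M) (c : Ch n) (hc : bd c = 0)
    (hs : ∀ a, c a ≠ 0 → L ≤ a i ∧ a i ≤ M) (a : Fin n → ℤ) (ha : a i ≠ M) :
    (c + bd (hop i (Jb L M) c)) a = 0 := by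
  have hL' := hL
  rw [Int.even_iff] at hL hM
  rw [bd_hop i _ c hc, Pi.add_apply]
  have hca : ¬ (L ≤ a i ∧ a i ≤ M) → c a = 0 := by
    intro h; by_contra h'; exact h (hs a h')
  rcases Int.even_or_odd (a i) with he | he
  · rw [hcomb_even i _ c a he]
    have he' := he
    rw [Int.even_iff] at he'
    by_cases h1 : a i < M
    · by_cases h2 : L ≤ a i
      · have h1 : Jb L M (a i + 1) = insert (a i) (Jb L M (a i - 1)) := by
          unfold Jb
          rw [if_pos (by omega), if_pos (by omega), evI_right he (by omega)]
        have h2 : a i ∉ Jb L M (a i - 1) := by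
          unfold Jb evI; rw [if_pos (by omega)]; simp
        rw [h1, Finset.sum_insert h2, Function.update_eq_self]
        generalize c a = x
        generalize ∑ v ∈ Jb L M (a i - 1), c (Function.update a i v) = y
        revert x y; decide
      · have e1 : Jb L M (a i + 1) = ∅ := by
          unfold Jb; rw [if_pos (by omega), evI_empty (by omega)]
        have e2 : Jb L M (a i - 1) = ∅ := by
          unfold Jb; rw [if_pos (by omega), evI_empty (by omega)]
        rw [e1, e2, hca (by omega)]; simp
    · have e1 : Jb L M (a i + 1) = ∅ := by unfold Jb; rw [if_neg (by omega)]
      have e2 : Jb L M (a i - 1) = ∅ := by unfold Jb; rw [if_neg (by omega)]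
      rw [e1, e2, hca (by omega)]; simp
  · rw [hcomb_odd i _ c a he (fun v hv => by
      unfold Jb evI at hv; split_ifs at hv
      · exact (Finset.mem_filter.1 hv).2
      · simp at hv)]
    have he' := he
    rw [Int.odd_iff] at he'
    by_cases h1 : a i < M
    · by_cases h2 : L ≤ a i
      · have hL2 : Even (L - 2) := by rw [Int.even_iff]; omega
        unfold Jb
        rw [if_pos h1, tele_right (fun v => c (Function.update a i v)) hL2 he (by omega)]
        simp only [Function.update_eq_self]
        have : c (Function.update a i (L - 2 + 1)) = 0 := by
          by_contra h'
          have := hs _ h'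
          simp at this
          omega
        rw [this, add_zero, CharTwo.add_self_eq_zero]
      · have e1 : Jb L M (a i) = ∅ := by
          unfold Jb; rw [if_pos (by omega), evI_empty (by omega)]
        rw [e1, hca (by omega)]; simp
    · have e1 : Jb L M (a i) = ∅ := by
          unfold Jb; rw [if_neg (by omega)]
      rw [e1, hca (by omega)]; simp

/-- augmentation -/
noncomputable def aug (c : Ch n) : ZMod 2 := ∑ᶠ v : Fin n → ℤ, c (fun i => 2 * v i)

theorem dbl_inj : Function.Injective (fun (v : Fin n → ℤ) i => 2 * v i) := by
  intro v w h; funext i; have := congrFun h i; simp only at this; omega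

theorem aug_add {c d : Ch n} (hc : (Function.support c).Finite) (hd : (Function.support d).Finite) :
    aug (c + d) = aug c + aug d := by
  unfold aug
  exact finsum_add_distrib (f := fun v : Fin n → ℤ => c (fun i => 2 * v i))
    (g := fun v : Fin n → ℤ => d (fun i => 2 * v i))
    (hc.preimage (f := fun (v : Fin n → ℤ) i => 2 * v i) dbl_inj.injOn)
    (hd.preimage (f := fun (v : Fin n → ℤ) i => 2 * v i) dbl_inj.injOn)

theorem upd_inj (i : Fin n) (t : ℤ) :
    Function.Injective (fun v : Fin n → ℤ => Function.update v i (v i + t)) := by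
  intro v w h
  funext j
  have := congrFun h j
  by_cases hj : j = i
  · subst hj; simpa using this
  · simpa [hj] using this

theorem finite_support_D (i : Fin n) {c : Ch n} (hc : (Function.support c).Finite) :
    (Function.support (D i c)).Finite := by
  apply ((hc.preimage (f := fun v : Fin n → ℤ => Function.update v i (v i + 1))
    (upd_inj i 1).injOn).union (hc.preimage
      (f := fun v : Fin n → ℤ => Function.update v i (v i + (-1))) (upd_inj i (-1)).injOn)).subset
  intro a ha
  rw [Function.mem_support, D_apply] at ha
  split_ifs at ha
  · by_cases h0 : c (Function.update a i (a i + 1)) = 0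
    · right
      rw [h0, zero_add] at ha
      exact ha
    · left; exact h0
  · exact absurd rfl ha

theorem finite_support_bd {c : Ch n} (hc : (Function.support c).Finite) :
    (Function.support (bd c)).Finite := by
  apply (Set.finite_iUnion (fun i => finite_support_D i hc)).subset
  intro a ha
  rw [Function.mem_support, bd_apply] at ha
  obtain ⟨i, -, hi⟩ := Finset.exists_ne_zero_of_sum_ne_zero ha
  exact Set.mem_iUnion.2 ⟨i, hi⟩

theorem aug_sum {ι : Type*} (s : Finset ι) (c : ι → Ch n)
    (hc : ∀ i, (Function.support (c i)).Finite) :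
    aug (∑ i ∈ s, c i) = ∑ i ∈ s, aug (c i) ∧ (Function.support (∑ i ∈ s, c i)).Finite := by
  classical
  induction s using Finset.induction_on with
  | empty => simp [aug]
  | insert i s hi ih =>
    rw [Finset.sum_insert hi, Finset.sum_insert hi, aug_add (hc i) ih.2, ih.1]
    refine ⟨rfl, ((hc i).union ih.2).subset ?_⟩
    exact Function.support_add _ _

theorem aug_D (i : Fin n) {c : Ch n} (hc : (Function.support c).Finite) : aug (D i c) = 0 := by
  unfold aug
  have h1 : ∀ v : Fin n → ℤ, D i c (fun j => 2 * v j) =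
      c (Function.update (fun j => 2 * v j) i (2 * v i + 1)) +
      c (Function.update (fun j => 2 * v j) i (2 * v i - 1)) := by
    intro v; rw [D_apply, if_pos (even_two_mul _)]
  have hinj : ∀ t : ℤ, Function.Injective
      (fun (v : Fin n → ℤ) => Function.update (fun j => 2 * v j) i (2 * v i + t)) :=
    fun t => (upd_inj i t).comp dbl_inj
  simp only [h1]
  rw [finsum_add_distrib]
  · let e : (Fin n → ℤ) ≃ (Fin n → ℤ) := Equiv.addRight (Pi.single i 1)
    have h2 := finsum_comp_equiv (f := fun v : Fin n → ℤ =>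
      c (Function.update (fun j => 2 * v j) i (2 * v i - 1))) e
    rw [← h2]
    have h3 : ∀ v : Fin n → ℤ, Function.update (fun j => 2 * (e v) j) i (2 * (e v) i - 1) =
        Function.update (fun j => 2 * v j) i (2 * v i + 1) := by
      intro v
      funext j
      by_cases hj : j = i
      · subst hj; simp [e]; ring
      · simp [hj, e]
    simp only [h3]
    exact CharTwo.add_self_eq_zero _
  · exact hc.preimage (hinj 1).injOn
  · exact hc.preimage (hinj (-1)).injOn

theorem aug_bd {c : Ch n} (hc : (Function.support c).Finite) : aug (bd c) = 0 := by
  rw [bd_eq, (aug_sum _ _ (fun i => finite_support_D i hc)).1]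
  exact Finset.sum_eq_zero (fun i _ => aug_D i hc)

/-- Cycles in a box with vanishing augmentation bound in the box. -/
theorem box_acyclic (L M : Fin n → ℤ) (hL : ∀ i, Even (L i)) (hM : ∀ i, Even (M i)) (c : Ch n)
    (hc : bd c = 0) (hs : ∀ a, c a ≠ 0 → L ≤ a ∧ a ≤ M) (haug : aug c = 0) :
    ∃ e : Ch n, bd e = c ∧ ∀ a, e a ≠ 0 → L ≤ a ∧ a ≤ M := by
  classical
  have bdbox : ∀ e : Ch n, (∀ a, e a ≠ 0 → L ≤ a ∧ a ≤ M) → ∀ a, bd e a ≠ 0 → L ≤ a ∧ a ≤ M := by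
    intro e he a ha
    rw [bd_apply] at ha
    obtain ⟨i, -, hi⟩ := Finset.exists_ne_zero_of_sum_ne_zero ha
    rw [D_apply] at hi
    split_ifs at hi with hev
    · have key : ∀ v, (v = a i + 1 ∨ v = a i - 1) → e (Function.update a i v) ≠ 0 →
          L ≤ a ∧ a ≤ M := by
        intro v hv h
        have h1 := he _ h
        have h2 : ∀ j, L j ≤ a j ∧ a j ≤ M j := by
          intro j
          have l1 := h1.1 j
          have l2 := h1.2 j
          by_cases hj : j = i
          · subst hj
            have := hL j
            have := hM j
            rw [Int.even_iff] at *
            simp only [Function.update_self] at l1 l2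
            omega
          · simp only [Function.update_of_ne hj] at l1 l2
            exact ⟨l1, l2⟩
        exact ⟨fun j => (h2 j).1, fun j => (h2 j).2⟩
      by_cases h0 : e (Function.update a i (a i + 1)) = 0
      · rw [h0, zero_add] at hi
        exact key _ (Or.inr rfl) hi
      · exact key _ (Or.inl rfl) h0
    · exact absurd rfl hi
  have finbox : ∀ e : Ch n, (∀ a, e a ≠ 0 → L ≤ a ∧ a ≤ M) → (Function.support e).Finite :=
    fun e he => (Set.finite_Icc L M).subset he
  have addbox : ∀ e f : Ch n, (∀ a, e a ≠ 0 → L ≤ a ∧ a ≤ M) → (∀ a, f a ≠ 0 → L ≤ a ∧ a ≤ M) →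
      (∀ a, (e + f) a ≠ 0 → L ≤ a ∧ a ≤ M) := by
    intro e f he hf a ha
    by_cases h0 : e a = 0
    · apply hf a; simpa [h0] using ha
    · exact he a h0
  have key : ∀ s : Finset (Fin n), ∃ e : Ch n, (∀ a, e a ≠ 0 → L ≤ a ∧ a ≤ M) ∧
      ∀ a, (∃ i ∈ s, a i ≠ M i) → (c + bd e) a = 0 := by
    intro s
    induction s using Finset.induction_on with
    | empty => exact ⟨0, by simp, by simp⟩
    | insert i s hi ih =>
      obtain ⟨e, he, hz⟩ := ih
      have hc' : bd (c + bd e) = 0 := by rw [map_add, hc, bd_bd, zero_add]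
      have hbox := addbox _ _ hs (bdbox e he)
      refine ⟨e + hop i (Jb (L i) (M i)) (c + bd e), addbox _ _ he ?_, ?_⟩
      · intro a ha
        rw [hop_apply] at ha
        split_ifs at ha with hodd
        · obtain ⟨v, hvJ, hv⟩ := Finset.exists_ne_zero_of_sum_ne_zero ha
          have h1 := hbox _ hv
          have h2 : ∀ j, L j ≤ a j ∧ a j ≤ M j := by
            intro j
            have l1 := h1.1 j
            have l2 := h1.2 j
            by_cases hj : j = i
            · subst hj
              unfold Jb evI at hvJ
              split_ifs at hvJ
              · simp only [Finset.mem_filter, Finset.mem_Ioo] at hvJ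
                simp only [Function.update_self] at l1 l2
                omega
              · simp at hvJ
            · simp only [Function.update_of_ne hj] at l1 l2
              exact ⟨l1, l2⟩
          exact ⟨fun j => (h2 j).1, fun j => (h2 j).2⟩
        · exact absurd rfl ha
      · intro a ha
        rw [map_add, ← add_assoc]
        by_cases hai : a i = M i
        · obtain ⟨j, hj, hja⟩ := ha
          have hji : j ≠ i := by rintro rfl; exact hja hai
          have hjs : j ∈ s := by simpa [hji] using hj
          rw [bd_hop i _ _ hc', Pi.add_apply, hz a ⟨j, hjs, hja⟩]
          have hz' : ∀ v, (c + bd e) (Function.update a i v) = 0 := by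
            intro v; apply hz; exact ⟨j, hjs, by rwa [Function.update_of_ne hji]⟩
          simp only [Pi.add_apply (D i _), D_apply, hop_apply, Function.update_self,
            Function.update_idem, hz', Finset.sum_const_zero, ite_self, add_zero]
        · exact push_box i _ _ (hL i) (hM i) _ hc' (fun b hb => ⟨(hbox b hb).1 i, (hbox b hb).2 i⟩)
            a hai
  obtain ⟨e, he, hz⟩ := key Finset.univ
  refine ⟨e, ?_, he⟩
  have hz2 : ∀ a, a ≠ M → (c + bd e) a = 0 := by
    intro a ha
    apply hz
    by_contra hcon
    push Not at hcon
    exact ha (funext fun i => hcon i (Finset.mem_univ i))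
  have h1 : aug (c + bd e) = 0 := by
    rw [aug_add (finbox c hs) (finite_support_bd (finbox e he)), haug, aug_bd (finbox e he), add_zero]
  have hM2 : (fun i => 2 * (M i / 2)) = M := by
    funext i; have := hM i; rw [Int.even_iff] at this; omega
  have h2 : (c + bd e) M = 0 := by
    rw [← h1]
    unfold aug
    rw [finsum_eq_single _ (fun i => M i / 2)]
    · rw [hM2]
    · intro v hv
      apply hz2
      intro h
      apply hv
      funext i
      have := congrFun h i
      change 2 * v i = M i at this
      omega
  have : c + bd e = 0 := by
    funext a
    by_cases h : a = M
    · rw [h]; exact h2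
    · exact hz2 a h
  have h2 := ch_add_self c
  rw [← this] at h2
  exact (add_left_cancel h2).symm

end LJB


namespace LJB
open Filter Topology

variable {n m : ℕ}

/-! Chains up to subdivision, as eventually compatible sequences -/

abbrev Sq (n : ℕ) := ℕ → Ch n

def IsC (z : Sq n) : Prop := ∀ᶠ N in atTop, z (N + 1) = sd (z N)
def Av (K : Set (Fin n → ℝ)) (z : Sq n) : Prop := ∀ᶠ N in atTop, Avoids N (z N) K
def Cy (z : Sq n) : Prop := ∀ᶠ N in atTop, bd (z N) = 0
def HmS (d : ℕ) (z : Sq n) : Prop := ∀ᶠ N in atTop, Hm d (z N)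
/-- `z` bounds off `K` -/
def Bd (K : Set (Fin n → ℝ)) (z : Sq n) : Prop :=
  ∃ c : Sq n, IsC c ∧ Av K c ∧ ∀ᶠ N in atTop, bd (c N) = z N
/-- `z` is a cycle off `K` -/
structure Zc (K : Set (Fin n → ℝ)) (z : Sq n) : Prop where
  isC : IsC z
  cy : Cy z
  av : Av K z
def Acyc (K : Set (Fin n → ℝ)) : Prop := ∀ z : Sq n, Zc K z → Bd K z

theorem IsC.add {z w : Sq n} (hz : IsC z) (hw : IsC w) : IsC (z + w) := by
  filter_upwards [hz, hw] with N h1 h2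
  simp only [Pi.add_apply, h1, h2, map_add]

theorem Av.add {K} {z w : Sq n} (hz : Av K z) (hw : Av K w) : Av K (z + w) := by
  filter_upwards [hz, hw] with N h1 h2 using h1.add h2

theorem Av.mono {K L} {z : Sq n} (hz : Av K z) (h : L ⊆ K) : Av L z := by
  filter_upwards [hz] with N h1 using h1.mono h

theorem Av.union {K L} {z : Sq n} (hz : Av K z) (h : Av L z) : Av (K ∪ L) z := by
  filter_upwards [hz, h] with N h1 h2 using h1.union h2

theorem Zc.add {K} {z w : Sq n} (hz : Zc K z) (hw : Zc K w) : Zc K (z + w) := by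
  refine ⟨hz.1.add hw.1, ?_, hz.3.add hw.3⟩
  filter_upwards [hz.2, hw.2] with N h1 h2
  simp [h1, h2]

theorem Zc.mono {K L} {z : Sq n} (hz : Zc K z) (h : L ⊆ K) : Zc L z := ⟨hz.1, hz.2, hz.3.mono h⟩

theorem Bd.mono {K L} {z : Sq n} (hz : Bd K z) (h : L ⊆ K) : Bd L z := by
  obtain ⟨c, h1, h2, h3⟩ := hz
  exact ⟨c, h1, h2.mono h, h3⟩

theorem Bd.add {K} {z w : Sq n} (hz : Bd K z) (hw : Bd K w) : Bd K (z + w) := by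
  obtain ⟨c, h1, h2, h3⟩ := hz
  obtain ⟨d, k1, k2, k3⟩ := hw
  refine ⟨c + d, h1.add k1, h2.add k2, ?_⟩
  filter_upwards [h3, k3] with N e1 e2
  simp [e1, e2]

theorem Bd.congr {K} {z w : Sq n} (hz : Bd K z) (h : ∀ᶠ N in atTop, z N = w N) : Bd K w := by
  obtain ⟨c, h1, h2, h3⟩ := hz
  refine ⟨c, h1, h2, ?_⟩
  filter_upwards [h3, h] with N e1 e2
  rw [e1, e2]

theorem Zc.congr {K} {z w : Sq n} (hz : Zc K z) (h : ∀ᶠ N in atTop, z N = w N) : Zc K w := by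
  refine ⟨?_, ?_, ?_⟩
  · filter_upwards [hz.1, h, (tendsto_add_atTop_nat 1).eventually h] with N h1 h2 h3
    rw [← h2, ← h3, h1]
  · filter_upwards [hz.2, h] with N h1 h2
    rw [← h2, h1]
  · filter_upwards [hz.3, h] with N h1 h2
    rw [← h2]; exact h1

theorem IsC.bd {z : Sq n} (hz : IsC z) : IsC (fun N => bd (z N)) := by
  filter_upwards [hz] with N h
  rw [h, bd_sd]

theorem Av.bd {K} {z : Sq n} (hz : Av K z) : Av K (fun N => bd (z N)) := by
  filter_upwards [hz] with N h using h.bd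

theorem Zc_bd {K} {z : Sq n} (hz : IsC z) (h : Av K z) : Zc K (fun N => bd (z N)) :=
  ⟨hz.bd, Eventually.of_forall fun N => bd_bd _, h.bd⟩

/-- sequence generated by a chain of level `N₀` -/
def ext (N₀ : ℕ) (c : Ch n) : Sq n := fun N => sd^[N - N₀] c

theorem ext_self (N₀ : ℕ) (c : Ch n) : ext N₀ c N₀ = c := by simp [ext]

theorem ext_succ (N₀ : ℕ) (c : Ch n) {N : ℕ} (h : N₀ ≤ N) : ext N₀ c (N + 1) = sd (ext N₀ c N) := by
  unfold ext
  rw [show N + 1 - N₀ = (N - N₀) + 1 by omega, Function.iterate_succ_apply']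

theorem ext_isC (N₀ : ℕ) (c : Ch n) : IsC (ext N₀ c) :=
  eventually_atTop.2 ⟨N₀, fun _ h => ext_succ N₀ c h⟩

theorem ext_prop (N₀ : ℕ) (c : Ch n) (Pr : ℕ → Ch n → Prop) (h0 : Pr N₀ c)
    (hs : ∀ N ≥ N₀, ∀ d, Pr N d → Pr (N + 1) (sd d)) : ∀ N ≥ N₀, Pr N (ext N₀ c N) := by
  intro N hN
  induction N, hN using Nat.le_induction with
  | base => rwa [ext_self]
  | succ N hN ih => rw [ext_succ N₀ c hN]; exact hs N hN _ ih

theorem ext_av {K} (N₀ : ℕ) (c : Ch n) (h : Avoids N₀ c K) : Av K (ext N₀ c) :=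
  eventually_atTop.2 ⟨N₀, ext_prop N₀ c (fun N d => Avoids N d K) h fun _ _ _ h => h.sd⟩

theorem ext_hm {d} (N₀ : ℕ) (c : Ch n) (h : Hm d c) : HmS d (ext N₀ c) :=
  eventually_atTop.2 ⟨N₀, ext_prop N₀ c (fun _ e => Hm d e) h fun _ _ _ h => h.sd⟩

theorem Bd_of_level {K} {z : Sq n} {N₀ : ℕ} (hz : ∀ N ≥ N₀, z (N + 1) = sd (z N)) (c : Ch n)
    (hc : bd c = z N₀) (hK : Avoids N₀ c K) : Bd K z := by
  refine ⟨ext N₀ c, ext_isC _ _, ext_av _ _ hK, eventually_atTop.2 ⟨N₀, ?_⟩⟩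
  apply ext_prop N₀ c (fun N d => bd d = z N) hc
  intro N hN d hd
  rw [bd_sd, hd, hz N hN]

theorem eq_of_level {z w : Sq n} {N₀ : ℕ} (hz : ∀ N ≥ N₀, z (N + 1) = sd (z N))
    (hw : ∀ N ≥ N₀, w (N + 1) = sd (w N)) (h : z N₀ = w N₀) : ∀ N ≥ N₀, z N = w N := by
  intro N hN
  induction N, hN using Nat.le_induction with
  | base => exact h
  | succ N hN ih => rw [hz N hN, hw N hN, ih]

theorem avoids_supp (N : ℕ) (c : Ch n) : Avoids N c (supp N c)ᶜ := by
  rw [avoids_iff]; exact disjoint_compl_right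

theorem avoids_level {z : Sq n} {N₀ : ℕ} (hz : ∀ N ≥ N₀, z (N + 1) = sd (z N)) {K}
    (h : Avoids N₀ (z N₀) K) : ∀ N ≥ N₀, Avoids N (z N) K := by
  intro N hN
  induction N, hN using Nat.le_induction with
  | base => exact h
  | succ N hN ih => rw [hz N hN]; exact ih.sd

theorem exists_mesh {ε : ℝ} (hε : 0 < ε) (N₀ : ℕ) : ∃ M ≥ N₀, (1 : ℝ) / 2 ^ M < ε := by
  have h : Tendsto (fun M : ℕ => (1 / 2 : ℝ) ^ M) atTop (𝓝 0) :=
    tendsto_pow_atTop_nhds_zero_of_lt_one (by norm_num) (by norm_num)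
  obtain ⟨M, h1, h2⟩ := ((h.eventually (gt_mem_nhds hε)).and (eventually_ge_atTop N₀)).exists
  exact ⟨M, h2, by simpa using h1⟩

theorem split {c : Sq n} (hc : IsC c) {K₁ K₂} (h1 : IsCompact K₁) (h2 : IsClosed K₂)
    (hK : Av (K₁ ∩ K₂) c) (d : ℕ) : ∃ c₁ c₂ : Sq n, IsC c₁ ∧ IsC c₂ ∧ Av K₁ c₁ ∧ Av K₂ c₂ ∧
      (∀ᶠ N in atTop, c N = c₁ N + c₂ N) ∧ (HmS d c → HmS d c₁ ∧ HmS d c₂) := by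
  have hd : ∃ N₀, HmS d c → ∀ N ≥ N₀, Hm d (c N) := by
    by_cases h : HmS d c
    · obtain ⟨N₀, h⟩ := eventually_atTop.1 h
      exact ⟨N₀, fun _ => h⟩
    · exact ⟨0, fun h' => absurd h' h⟩
  obtain ⟨N₁, hd⟩ := hd
  obtain ⟨N₂, hN₂⟩ := eventually_atTop.1 (hc.and hK)
  set N₀ := max N₁ N₂
  have hcc : ∀ N ≥ N₀, c (N + 1) = sd (c N) := fun N hN => (hN₂ N (le_trans (le_max_right _ _) hN)).1
  have hav : Avoids N₀ (c N₀) (K₁ ∩ K₂) := (hN₂ N₀ (le_max_right _ _)).2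
  have hdis : Disjoint (K₁ ∩ supp N₀ (c N₀)) (K₂ ∩ supp N₀ (c N₀)) := by
    rw [avoids_iff] at hav
    rw [Set.disjoint_left] at hav ⊢
    rintro x ⟨hx1, hx2⟩ ⟨hx3, -⟩
    exact hav hx2 ⟨hx1, hx3⟩
  obtain ⟨δ, hδ, hth⟩ := hdis.exists_thickenings (h1.inter_right (supp_closed _ _))
    (h2.inter (supp_closed _ _))
  obtain ⟨M, hM, hMδ⟩ := exists_mesh hδ N₀
  have hsup := avoids_level hcc (avoids_supp N₀ (c N₀)) M hM
  let P : (Fin n → ℤ) → Prop := fun a => Disjoint (cell M a) K₁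
  refine ⟨ext M (rs P (c M)), ext M (rs (fun a => ¬ P a) (c M)), ext_isC _ _, ext_isC _ _,
    ext_av _ _ ?_, ext_av _ _ ?_, eventually_atTop.2 ⟨M, ?_⟩, ?_⟩
  · intro a ha; exact (rs_ne ha).1
  · intro a ha
    obtain ⟨hP, hca⟩ := rs_ne ha
    have hs := hsup a hca
    rw [Set.disjoint_compl_right_iff_subset] at hs
    obtain ⟨x, hx, hx1⟩ := Set.not_disjoint_iff.1 hP
    rw [Set.disjoint_left]
    intro y hy hy2
    rw [Set.disjoint_left] at hth
    refine hth (a := y) ?_ ?_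
    · rw [Metric.mem_thickening_iff]
      exact ⟨x, ⟨hx1, hs hx⟩, lt_of_le_of_lt (cell_dist M a hy hx) hMδ⟩
    · exact Metric.self_subset_thickening hδ _ ⟨hy2, hs hy⟩
  · apply eq_of_level (w := ext M (rs P (c M)) + ext M (rs (fun a => ¬ P a) (c M)))
      (fun N hN => hcc N (le_trans hM hN))
    · intro N hN
      simp only [Pi.add_apply, ext_succ _ _ hN, map_add]
    · simp only [Pi.add_apply, ext_self]; exact rs_add_not P (c M)
  · intro h
    have := hd h M (le_trans (le_max_left _ _) hM)
    exact ⟨ext_hm _ _ (this.rs _), ext_hm _ _ (this.rs _)⟩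

theorem sq_cancel (a b c : Ch n) (h : a + b = c) : a = c + b := by
  rw [← h, add_assoc, ch_add_self, add_zero]

/-- Mayer–Vietoris gluing -/
theorem mv_glue {K₁ K₂ : Set (Fin n → ℝ)} (h1 : IsCompact K₁) (h2 : IsCompact K₂) {z a b : Sq n}
    (ha : IsC a) (haK : Av K₁ a) (hbK : Av K₂ b)
    (haz : ∀ᶠ N in atTop, bd (a N) = z N)
    (hab : Bd (K₁ ∩ K₂) (a + b)) : Bd (K₁ ∪ K₂) z := by
  obtain ⟨c, hc, hcK, hcb⟩ := hab
  obtain ⟨c₁, c₂, hc1, hc2, hk1, hk2, hcc, -⟩ := split hc h1 h2.isClosed hcK 0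
  refine ⟨a + (fun N => bd (c₁ N)), ha.add hc1.bd, ?_, ?_⟩
  · apply Av.union (haK.add hk1.bd)
    have := hbK.add hk2.bd
    filter_upwards [this, hcb, hcc] with N e1 e2 e3
    have : (a + fun N => bd (c₁ N)) N = (b + fun N => bd (c₂ N)) N := by
      simp only [Pi.add_apply] at *
      rw [e3, map_add] at e2
      have e4 := sq_cancel _ _ _ e2
      rw [e4, ← add_assoc, ← add_assoc, ch_add_self, zero_add]
    rw [this]; exact e1
  · filter_upwards [haz] with N e1
    simp only [Pi.add_apply, map_add, e1, bd_bd, add_zero]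

theorem mv_acyc {K₁ K₂ : Set (Fin n → ℝ)} (h1 : IsCompact K₁) (h2 : IsCompact K₂) {z : Sq n}
    (hz1 : Bd K₁ z) (hz2 : Bd K₂ z) (h : Acyc (K₁ ∩ K₂)) : Bd (K₁ ∪ K₂) z := by
  obtain ⟨a, ha1, ha2, ha3⟩ := hz1
  obtain ⟨b, hb1, hb2, hb3⟩ := hz2
  refine mv_glue h1 h2 ha1 ha2 hb2 ha3 (h _ ⟨ha1.add hb1, ?_, ?_⟩)
  · filter_upwards [ha3, hb3] with N e1 e2
    simp only [Pi.add_apply, map_add, e1, e2]; exact ch_add_self _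
  · exact (ha2.mono Set.inter_subset_left).add (hb2.mono Set.inter_subset_right)

theorem acyc_union {K₁ K₂ : Set (Fin n → ℝ)} (h1 : IsCompact K₁) (h2 : IsCompact K₂)
    (hz1 : Acyc K₁) (hz2 : Acyc K₂) (h : Acyc (K₁ ∩ K₂)) : Acyc (K₁ ∪ K₂) := fun z hz =>
  mv_acyc h1 h2 (hz1 z (hz.mono Set.subset_union_left)) (hz2 z (hz.mono Set.subset_union_right)) h

theorem acyc_point (p : Fin n → ℝ) : Acyc {p} := by
  intro z hz
  obtain ⟨N₀, hN₀⟩ := eventually_atTop.1 (hz.1.and (hz.2.and hz.3))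
  have hcc : ∀ N ≥ N₀, z (N + 1) = sd (z N) := fun N hN => (hN₀ N hN).1
  have hav : Avoids N₀ (z N₀) {p} := (hN₀ N₀ le_rfl).2.2
  rw [avoids_iff, Set.disjoint_singleton_right] at hav
  obtain ⟨ε, hε, hball⟩ := Metric.isOpen_iff.1 (supp_closed N₀ (z N₀)).isOpen_compl p hav
  obtain ⟨M, hM, hMε⟩ := exists_mesh hε N₀
  have hsup := avoids_level hcc ((avoids_supp N₀ (z N₀)).mono hball) M hM
  have h2 : (0 : ℝ) < 2 ^ M := by positivity
  let k : Fin n → ℤ := fun i => round (p i * 2 ^ M)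
  have hk : ∀ i, |p i * 2 ^ M - k i| ≤ 1 / 2 := fun i => abs_sub_round _
  obtain ⟨e, he, hea⟩ := push_all (fun i => 2 * k i) (fun i => even_two_mul _) (z M)
    (hN₀ M hM).2.1 (by
      intro a ha
      by_contra h0
      have hd := hsup a h0
      rw [Set.disjoint_left] at hd
      refine hd (a := fun i => (k i : ℝ) / 2 ^ M) ?_ ?_
      · intro i
        have h1 := ha i
        rw [abs_le] at h1
        rw [div_mul_cancel₀ _ h2.ne']
        constructor
        · exact_mod_cast (by omega : a i / 2 ≤ k i)
        · exact_mod_cast (by omega : k i ≤ (a i + 1) / 2)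
      · rw [Metric.mem_ball]
        refine lt_of_le_of_lt ?_ hMε
        rw [dist_pi_le_iff (by positivity)]
        intro i
        have h1 := hk i
        rw [abs_le] at h1
        rw [Real.dist_eq, abs_le, ← neg_div, div_le_iff₀ h2, le_div_iff₀ h2, sub_mul,
          div_mul_cancel₀ _ h2.ne']
        constructor <;> linarith)
  refine Bd_of_level (N₀ := M) (fun N hN => hcc N (le_trans hM hN)) e he ?_
  intro a ha
  rw [Set.disjoint_singleton_right]
  intro hp
  obtain ⟨i, hi⟩ := hea a ha
  have h1 := hk i
  rw [abs_le] at h1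
  have h3 := hp i
  rw [le_abs] at hi
  rcases hi with hi | hi
  · have h4 : ((k i + 1 : ℤ) : ℝ) ≤ ((a i / 2 : ℤ) : ℝ) := by exact_mod_cast (by omega)
    push_cast at h4
    linarith
  · have h4 : (((a i + 1) / 2 : ℤ) : ℝ) ≤ ((k i - 1 : ℤ) : ℝ) := by exact_mod_cast (by omega)
    push_cast at h4
    linarith

/-- an embedded closed box -/
structure Emb (m n : ℕ) where
  φ : (Fin m → ℝ) → (Fin n → ℝ)
  A : Fin m → ℝ
  B : Fin m → ℝ
  cont : ContinuousOn φ (Set.Icc A B)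
  inj : Set.InjOn φ (Set.Icc A B)

variable (E : Emb m n)

/-- closed subsets of the box with acyclic image -/
structure Good (X : Set (Fin m → ℝ)) : Prop where
  sub : X ⊆ Set.Icc E.A E.B
  closed : IsClosed X
  acyc : Acyc (E.φ '' X)

variable {E}

theorem Emb.compact {X : Set (Fin m → ℝ)} (h : X ⊆ Set.Icc E.A E.B) (hX : IsClosed X) :
    IsCompact (E.φ '' X) :=
  (isCompact_Icc.of_isClosed_subset hX h).image_of_continuousOn (E.cont.mono h)

theorem Good.union {X Y : Set (Fin m → ℝ)} (hX : Good E X) (hY : Good E Y) (h : Good E (X ∩ Y)) :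
    Good E (X ∪ Y) := by
  refine ⟨Set.union_subset hX.1 hY.1, hX.2.union hY.2, ?_⟩
  rw [Set.image_union]
  apply acyc_union (E.compact hX.1 hX.2) (E.compact hY.1 hY.2) hX.3 hY.3
  rw [← E.inj.image_inter hX.1 hY.1]
  exact h.3

theorem slab_union (a b : Fin m → ℝ) (i : Fin m) {u v w : ℝ} (h1 : u ≤ v) (h2 : v ≤ w) :
    Set.Icc (Function.update a i u) (Function.update b i v) ∪
      Set.Icc (Function.update a i v) (Function.update b i w) =
    Set.Icc (Function.update a i u) (Function.update b i w) := by
  ext x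
  simp only [Set.mem_union, Set.mem_Icc, update_le_iff, le_update_iff]
  constructor
  · rintro (⟨⟨h, h'⟩, k, k'⟩ | ⟨⟨h, h'⟩, k, k'⟩)
    · exact ⟨⟨h, h'⟩, by linarith, k'⟩
    · exact ⟨⟨by linarith, h'⟩, k, k'⟩
  · rintro ⟨⟨h, h'⟩, k, k'⟩
    rcases le_total (x i) v with hv | hv
    · exact Or.inl ⟨⟨h, h'⟩, hv, k'⟩
    · exact Or.inr ⟨⟨hv, h'⟩, k, k'⟩

theorem slab_inter (a b : Fin m → ℝ) (i : Fin m) {u v w : ℝ} (h1 : u ≤ v) (h2 : v ≤ w) :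
    Set.Icc (Function.update a i u) (Function.update b i v) ∩
      Set.Icc (Function.update a i v) (Function.update b i w) =
    Set.Icc (Function.update a i v) (Function.update b i v) := by
  ext x
  simp only [Set.mem_inter_iff, Set.mem_Icc, update_le_iff, le_update_iff]
  constructor
  · rintro ⟨⟨⟨h, h'⟩, k, k'⟩, ⟨⟨l, l'⟩, r, r'⟩⟩
    exact ⟨⟨l, h'⟩, k, k'⟩
  · rintro ⟨⟨h, h'⟩, k, k'⟩
    exact ⟨⟨⟨by linarith, h'⟩, k, k'⟩, ⟨⟨h, h'⟩, by linarith, k'⟩⟩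

theorem slab_mono (a b : Fin m → ℝ) (i : Fin m) {u v u' v' : ℝ} (h1 : u' ≤ u) (h2 : v ≤ v') :
    Set.Icc (Function.update a i u) (Function.update b i v) ⊆
      Set.Icc (Function.update a i u') (Function.update b i v') :=
  Set.Icc_subset_Icc (update_le_update_iff.2 ⟨h1, fun _ _ => le_rfl⟩)
    (update_le_update_iff.2 ⟨h2, fun _ _ => le_rfl⟩)

theorem good_box (s : Finset (Fin m)) : ∀ a b : Fin m → ℝ, a ≤ b → (∀ i, i ∉ s → a i = b i) →
    Set.Icc a b ⊆ Set.Icc E.A E.B → Good E (Set.Icc a b) := by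
  induction s using Finset.induction_on with
  | empty =>
    intro a b hab h hQ
    have : a = b := funext fun i => h i (by simp)
    subst this
    refine ⟨hQ, isClosed_Icc, ?_⟩
    rw [Set.Icc_self, Set.image_singleton]
    exact acyc_point _
  | insert i s hi ih =>
    intro a b hab h hQ
    refine ⟨hQ, isClosed_Icc, ?_⟩
    let K : ℝ → ℝ → Set (Fin m → ℝ) := fun u v =>
      Set.Icc (Function.update a i u) (Function.update b i v)
    have hKsub : ∀ u v, a i ≤ u → v ≤ b i → K u v ⊆ Set.Icc a b := by
      intro u v hu hv
      have := slab_mono a b i hu hv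
      simpa using this
    have hKt : ∀ t, a i ≤ t → t ≤ b i → Good E (K t t) := by
      intro t h1 h2
      apply ih
      · exact update_le_update_iff.2 ⟨le_rfl, fun j _ => hab j⟩
      · intro j hj
        by_cases hji : j = i
        · subst hji; simp
        · simp only [Function.update_of_ne hji]
          exact h j (by simp [hji, hj])
      · exact (hKsub t t h1 h2).trans hQ
    intro z hz
    have hglue : ∀ u v w, a i ≤ u → u ≤ v → v ≤ w → w ≤ b i → Bd (E.φ '' K u v) z →
        Bd (E.φ '' K v w) z → Bd (E.φ '' K u w) z := by
      intro u v w hu huv hvw hw h1 h2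
      have e1 := (hKsub u v hu (by linarith)).trans hQ
      have e2 := (hKsub v w (by linarith) hw).trans hQ
      have := mv_acyc (E.compact e1 isClosed_Icc) (E.compact e2 isClosed_Icc) h1 h2 (by
        rw [← E.inj.image_inter e1 e2]
        simp only [K]
        rw [slab_inter a b i huv hvw]
        exact (hKt v (by linarith) (by linarith)).3)
      rw [← Set.image_union] at this
      simp only [K] at this ⊢
      rwa [slab_union a b i huv hvw] at this
    have hmono : ∀ u v u' v', u' ≤ u → v ≤ v' → Bd (E.φ '' K u' v') z → Bd (E.φ '' K u v) z := by
      intro u v u' v' h1 h2 h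
      exact h.mono (Set.image_mono (slab_mono a b i h1 h2))
    have hR : Bd (E.φ '' K (min (a i) (b i)) (max (a i) (b i))) z := by
      refine (isPreconnected_Icc (a := a i) (b := b i)).induction₂
        (fun u v => Bd (E.φ '' K (min u v) (max u v)) z) ?_ ?_ ?_
        (Set.left_mem_Icc.2 (hab i)) (Set.right_mem_Icc.2 (hab i))
      · intro t ht
        have hbt : Bd (E.φ '' K t t) z := by
          apply (hKt t ht.1 ht.2).3
          exact hz.mono (Set.image_mono (hKsub t t ht.1 ht.2))
        obtain ⟨c, hc1, hc2, hc3⟩ := hbt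
        obtain ⟨N₀, hN₀⟩ := eventually_atTop.1 (hc1.and hc2)
        have hav := (hN₀ N₀ le_rfl).2
        rw [avoids_iff] at hav
        -- the set of parameters where the chain meets the box
        have hcomp : IsCompact ((fun x : Fin m → ℝ => x i) ''
            (Set.Icc a b ∩ E.φ ⁻¹' (supp N₀ (c N₀)))) := by
          apply IsCompact.image _ (continuous_apply i)
          apply isCompact_Icc.of_isClosed_subset _ Set.inter_subset_left
          exact (E.cont.mono hQ).preimage_isClosed_of_isClosed isClosed_Icc (supp_closed _ _)
        have htn : t ∉ ((fun x : Fin m → ℝ => x i) ''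
            (Set.Icc a b ∩ E.φ ⁻¹' (supp N₀ (c N₀)))) := by
          rintro ⟨x, ⟨hx1, hx2⟩, hx3⟩
          rw [Set.disjoint_left] at hav
          refine hav hx2 ⟨x, ?_, rfl⟩
          simp only [K, Set.mem_Icc, update_le_iff, le_update_iff]
          exact ⟨⟨hx3.ge, fun j _ => hx1.1 j⟩, hx3.le, fun j _ => hx1.2 j⟩
        obtain ⟨ε, hε, hball⟩ := Metric.isOpen_iff.1 hcomp.isClosed.isOpen_compl t htn
        filter_upwards [nhdsWithin_le_nhds (Metric.ball_mem_nhds t hε), self_mem_nhdsWithin]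
          with y hy hyI
        refine ⟨c, hc1, ?_, hc3⟩
        refine eventually_atTop.2 ⟨N₀, avoids_level (fun N hN => (hN₀ N hN).1) ?_⟩
        rw [avoids_iff, Set.disjoint_left]
        rintro _ hx2 ⟨x, hxK, rfl⟩
        have hxab : x ∈ Set.Icc a b := hKsub _ _ (le_min ht.1 hyI.1) (max_le ht.2 hyI.2) hxK
        have hxi : x i ∈ Metric.ball t ε := by
          simp only [K, Set.mem_Icc, update_le_iff, le_update_iff] at hxK
          rw [Metric.mem_ball, Real.dist_eq, abs_lt] at hy ⊢
          have l1 := hxK.1.1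
          have l2 := hxK.2.1
          rw [min_le_iff] at l1
          rw [le_max_iff] at l2
          constructor
          · rcases l1 with l1 | l1 <;> linarith
          · rcases l2 with l2 | l2 <;> linarith
        exact hball hxi ⟨x, ⟨hxab, hx2⟩, rfl⟩
      · intro u v w hu hv hw h1 h2
        rcases le_total u v with huv | huv <;> rcases le_total v w with hvw | hvw <;>
          rcases le_total u w with huw | huw <;>
          simp only [huv, hvw, huw, min_eq_left, min_eq_right, max_eq_left, max_eq_right] at h1 h2 ⊢
        · exact hglue u v w hu.1 huv hvw hw.2 h1 h2
        · exact hmono _ _ _ _ (by linarith) (by linarith) h1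
        · exact hmono _ _ _ _ le_rfl hvw h1
        · exact hmono _ _ _ _ le_rfl huv h2
        · exact hmono _ _ _ _ huv le_rfl h2
        · exact hmono _ _ _ _ hvw le_rfl h1
        · exact hmono _ _ _ _ (by linarith) (by linarith) h1
        · exact hglue w v u hw.1 hvw huv hu.2 h2 h1
      · intro u v _ _ h
        rwa [min_comm, max_comm]
    rw [min_eq_left (hab i), max_eq_right (hab i)] at hR
    simpa [K] using hR

theorem good_Icc {a b : Fin m → ℝ} (hab : a ≤ b) (hQ : Set.Icc a b ⊆ Set.Icc E.A E.B) :
    Good E (Set.Icc a b) := good_box Finset.univ a b hab (fun i hi => absurd (Finset.mem_univ i) hi) hQ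

end LJB


namespace LJB
open Filter Topology

variable {n m : ℕ}

/-- part of a box lying outside some slabs -/
def Pb (a b α β : Fin m → ℝ) (s : Finset (Fin m)) : Set (Fin m → ℝ) :=
  {t | t ∈ Set.Icc a b ∧ ∃ i ∈ s, β i ≤ t i ∨ t i ≤ α i}

theorem Pb_closed (a b α β : Fin m → ℝ) (s : Finset (Fin m)) : IsClosed (Pb a b α β s) := by
  have : Pb a b α β s = Set.Icc a b ∩ ⋃ i ∈ s, ({t | β i ≤ t i} ∪ {t | t i ≤ α i}) := by
    ext t; simp [Pb]
  rw [this]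
  apply isClosed_Icc.inter
  apply isClosed_biUnion_finset
  intro i _
  exact (isClosed_le continuous_const (continuous_apply i)).union
    (isClosed_le (continuous_apply i) continuous_const)

theorem Pb_sub (a b α β : Fin m → ℝ) (s : Finset (Fin m)) : Pb a b α β s ⊆ Set.Icc a b :=
  fun _ h => h.1

theorem cone (E : Emb m n) (α β : Fin m → ℝ) (s : Finset (Fin m)) : ∀ a b a' b' : Fin m → ℝ,
    a ≤ b → a' ≤ a → b ≤ b' → Set.Icc a' b' ⊆ Set.Icc E.A E.B →
    (∀ i ∈ s, a i ≤ α i ∧ α i < β i ∧ β i ≤ b i) →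
    Good E (Set.Icc a b ∪ Pb a' b' α β s) := by
  induction s using Finset.induction_on with
  | empty =>
    intro a b a' b' h1 h2 h3 h4 _
    have : Pb a' b' α β ∅ = ∅ := by ext; simp [Pb]
    rw [this, Set.union_empty]
    exact good_Icc h1 ((Set.Icc_subset_Icc h2 h3).trans h4)
  | insert j s hj ih =>
    intro a b a' b' h1 h2 h3 h4 h5
    have hs : ∀ i ∈ s, a i ≤ α i ∧ α i < β i ∧ β i ≤ b i := fun i hi =>
      h5 i (Finset.mem_insert_of_mem hi)
    obtain ⟨k1, k2, k3⟩ := h5 j (Finset.mem_insert_self _ _)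
    have hne : ∀ i ∈ s, i ≠ j := fun i hi h => hj (h ▸ hi)
    have hup : ∀ {u v : Fin m → ℝ} {c : ℝ}, u ≤ v → c ≤ v j → Function.update u j c ≤ v := by
      intro u v c h h'
      exact update_le_iff.2 ⟨h', fun i _ => h i⟩
    have hdn : ∀ {u v : Fin m → ℝ} {c : ℝ}, v ≤ u → v j ≤ c → v ≤ Function.update u j c := by
      intro u v c h h'
      exact le_update_iff.2 ⟨h', fun i _ => h i⟩
    have huu : ∀ {u v : Fin m → ℝ} {c : ℝ}, v ≤ u → Function.update v j c ≤ Function.update u j c := by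
      intro u v c h
      exact update_le_update_iff.2 ⟨le_rfl, fun i _ => h i⟩
    have g0 := ih a b a' b' h1 h2 h3 h4 hs
    have hQ1 : Set.Icc (Function.update a' j (β j)) b' ⊆ Set.Icc E.A E.B :=
      (Set.Icc_subset_Icc (hdn le_rfl (by linarith [h2 j])) le_rfl).trans h4
    have hQ2 : Set.Icc a' (Function.update b' j (α j)) ⊆ Set.Icc E.A E.B :=
      (Set.Icc_subset_Icc le_rfl (hup le_rfl (by linarith [h3 j]))).trans h4
    have g1 : Good E (Set.Icc (Function.update a' j (β j)) b') :=
      good_Icc (hup (h2.trans (h1.trans h3)) (by linarith [h3 j])) hQ1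
    have g2 : Good E (Set.Icc a' (Function.update b' j (α j))) :=
      good_Icc (hdn (h2.trans (h1.trans h3)) (by linarith [h2 j])) hQ2
    have g3 := ih (Function.update a j (β j)) b (Function.update a' j (β j)) b'
      (hup h1 k3) (huu h2) h3 hQ1 (by
        intro i hi; rw [Function.update_of_ne (hne i hi)]; exact hs i hi)
    have g4 := ih a (Function.update b j (α j)) a' (Function.update b' j (α j))
      (hdn h1 k1) h2 (huu h3) hQ2 (by
        intro i hi; rw [Function.update_of_ne (hne i hi)]; exact hs i hi)
    have e1 : (Set.Icc a b ∪ Pb a' b' α β s) ∩ Set.Icc (Function.update a' j (β j)) b' =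
        Set.Icc (Function.update a j (β j)) b ∪ Pb (Function.update a' j (β j)) b' α β s := by
      ext t
      simp only [Pb, Set.mem_inter_iff, Set.mem_union, Set.mem_Icc, Set.mem_ofPred_eq, update_le_iff,
        le_update_iff]
      constructor
      · rintro ⟨⟨p1, p2⟩ | ⟨⟨p1, p2⟩, p3⟩, ⟨q1, q2⟩, q3⟩
        · exact Or.inl ⟨⟨q1, fun i _ => p1 i⟩, p2⟩
        · exact Or.inr ⟨⟨⟨q1, q2⟩, p2⟩, p3⟩
      · rintro (⟨⟨q1, q2⟩, p2⟩ | ⟨⟨⟨q1, q2⟩, p2⟩, p3⟩)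
        · have : a ≤ t := fun i => by
            by_cases h : i = j
            · subst h; linarith
            · exact q2 i h
          exact ⟨Or.inl ⟨this, p2⟩, ⟨q1, fun i _ => (h2 i).trans (this i)⟩, p2.trans h3⟩
        · have : a' ≤ t := fun i => by
            by_cases h : i = j
            · subst h; linarith [h2 i]
            · exact q2 i h
          exact ⟨Or.inr ⟨⟨this, p2⟩, p3⟩, ⟨q1, q2⟩, p2⟩
    have g5 := g0.union g1 (by rw [e1]; exact g3)
    have e2 : ((Set.Icc a b ∪ Pb a' b' α β s) ∪ Set.Icc (Function.update a' j (β j)) b') ∩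
        Set.Icc a' (Function.update b' j (α j)) =
        Set.Icc a (Function.update b j (α j)) ∪ Pb a' (Function.update b' j (α j)) α β s := by
      ext t
      simp only [Pb, Set.mem_inter_iff, Set.mem_union, Set.mem_Icc, Set.mem_ofPred_eq, update_le_iff,
        le_update_iff]
      constructor
      · rintro ⟨(⟨p1, p2⟩ | ⟨⟨p1, p2⟩, p3⟩) | ⟨⟨p1, p2⟩, p3⟩, q1, q2, q3⟩
        · exact Or.inl ⟨p1, q2, fun i _ => p2 i⟩
        · exact Or.inr ⟨⟨q1, q2, q3⟩, p3⟩
        · exfalso; linarith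
      · rintro (⟨p1, q2, q3⟩ | ⟨⟨q1, q2, q3⟩, p3⟩)
        · have : t ≤ b := fun i => by
            by_cases h : i = j
            · subst h; linarith
            · exact q3 i h
          exact ⟨Or.inl (Or.inl ⟨p1, this⟩), h2.trans p1, q2, fun i _ => (this i).trans (h3 i)⟩
        · have : t ≤ b' := fun i => by
            by_cases h : i = j
            · subst h; linarith [h3 i]
            · exact q3 i h
          exact ⟨Or.inl (Or.inr ⟨⟨q1, this⟩, p3⟩), q1, q2, q3⟩
    have g6 := g5.union g2 (by rw [e2]; exact g4)
    convert g6 using 1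
    ext t
    simp only [Pb, Set.mem_union, Set.mem_Icc, Set.mem_ofPred_eq, update_le_iff, le_update_iff,
      Finset.mem_insert]
    constructor
    · rintro (p | ⟨⟨p1, p2⟩, i, rfl | hi, hp | hp⟩)
      · exact Or.inl (Or.inl (Or.inl p))
      · exact Or.inl (Or.inr ⟨⟨hp, fun i _ => p1 i⟩, p2⟩)
      · exact Or.inr ⟨p1, hp, fun i _ => p2 i⟩
      · exact Or.inl (Or.inl (Or.inr ⟨⟨p1, p2⟩, i, hi, Or.inl hp⟩))
      · exact Or.inl (Or.inl (Or.inr ⟨⟨p1, p2⟩, i, hi, Or.inr hp⟩))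
    · rintro (((p | ⟨p1, i, hi, hp⟩) | ⟨⟨p1, p2⟩, p3⟩) | ⟨p1, p2, p3⟩)
      · exact Or.inl p
      · exact Or.inr ⟨p1, i, Or.inr hi, hp⟩
      · refine Or.inr ⟨⟨fun i => ?_, p3⟩, j, Or.inl rfl, Or.inl p1⟩
        by_cases h : i = j
        · subst h; linarith [h2 i]
        · exact p2 i h
      · refine Or.inr ⟨⟨p1, fun i => ?_⟩, j, Or.inl rfl, Or.inr p2⟩
        by_cases h : i = j
        · subst h; linarith [h3 i]
        · exact p3 i h

/-- the two halves in the Mayer–Vietoris step -/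
def M1 (E : Emb m n) (α β : Fin m → ℝ) (j : Fin m) (s : Finset (Fin m)) : Set (Fin m → ℝ) :=
  Set.Icc (Function.update E.A j (β j)) E.B ∪ Pb E.A E.B α β s
def M2 (E : Emb m n) (α β : Fin m → ℝ) (j : Fin m) (s : Finset (Fin m)) : Set (Fin m → ℝ) :=
  Set.Icc E.A (Function.update E.B j (α j)) ∪ Pb E.A E.B α β s

/-- admissible slab parameters -/
def Adm (E : Emb m n) (α β : Fin m → ℝ) : Prop := ∀ i, E.A i ≤ α i ∧ α i < β i ∧ β i ≤ E.B i

theorem Adm.le {E : Emb m n} {α β : Fin m → ℝ} (h : Adm E α β) : E.A ≤ E.B := fun i => by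
  linarith [(h i).1, (h i).2.1, (h i).2.2]

theorem good_M1 {E : Emb m n} {α β : Fin m → ℝ} (h : Adm E α β) {j : Fin m} {s : Finset (Fin m)}
    (hj : j ∉ s) : Good E (M1 E α β j s) := by
  apply cone E α β s _ _ _ _ _ _ le_rfl le_rfl
  · intro i hi
    rw [Function.update_of_ne (show i ≠ j from fun h => hj (h ▸ hi))]
    exact h i
  · exact update_le_iff.2 ⟨(h j).2.2, fun i _ => h.le i⟩
  · exact le_update_iff.2 ⟨by linarith [(h j).1, (h j).2.1], fun i _ => le_rfl⟩

theorem good_M2 {E : Emb m n} {α β : Fin m → ℝ} (h : Adm E α β) {j : Fin m} {s : Finset (Fin m)}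
    (hj : j ∉ s) : Good E (M2 E α β j s) := by
  apply cone E α β s _ _ _ _ _ le_rfl _ le_rfl
  · intro i hi
    rw [Function.update_of_ne (show i ≠ j from fun h => hj (h ▸ hi))]
    exact h i
  · exact le_update_iff.2 ⟨(h j).1, fun i _ => h.le i⟩
  · exact update_le_iff.2 ⟨by linarith [(h j).2.1, (h j).2.2], fun i _ => le_rfl⟩

theorem M_inter {E : Emb m n} {α β : Fin m → ℝ} (h : Adm E α β) (j : Fin m) (s : Finset (Fin m)) :
    M1 E α β j s ∩ M2 E α β j s = Pb E.A E.B α β s := by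
  rw [M1, M2, ← Set.inter_union_distrib_right]
  apply Set.union_eq_right.2
  rintro t ⟨h1, h2⟩
  have h3 := (update_le_iff.1 h1.1).1
  have h4 := (le_update_iff.1 h2.2).1
  exfalso; linarith [(h j).2.1]

theorem M_union {E : Emb m n} {α β : Fin m → ℝ} (h : Adm E α β) (j : Fin m) (s : Finset (Fin m)) :
    M1 E α β j s ∪ M2 E α β j s = Pb E.A E.B α β (insert j s) := by
  ext t
  simp only [M1, M2, Pb, Set.mem_union, Set.mem_Icc, Set.mem_ofPred_eq, update_le_iff, le_update_iff,
      Finset.mem_insert]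
  constructor
  · rintro ((⟨⟨p1, p2⟩, p3⟩ | ⟨p1, i, hi, hp⟩) | (⟨p1, p2, p3⟩ | ⟨p1, i, hi, hp⟩))
    · refine ⟨⟨fun i => ?_, p3⟩, j, Or.inl rfl, Or.inl p1⟩
      by_cases h' : i = j
      · subst h'; linarith [(h i).1, (h i).2.1]
      · exact p2 i h'
    · exact ⟨p1, i, Or.inr hi, hp⟩
    · refine ⟨⟨p1, fun i => ?_⟩, j, Or.inl rfl, Or.inr p2⟩
      by_cases h' : i = j
      · subst h'; linarith [(h i).2.1, (h i).2.2]
      · exact p3 i h'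
    · exact ⟨p1, i, Or.inr hi, hp⟩
  · rintro ⟨⟨p1, p2⟩, i, rfl | hi, hp | hp⟩
    · exact Or.inl (Or.inl ⟨⟨hp, fun i _ => p1 i⟩, p2⟩)
    · exact Or.inr (Or.inl ⟨p1, hp, fun i _ => p2 i⟩)
    · exact Or.inl (Or.inr ⟨⟨p1, p2⟩, i, hi, Or.inl hp⟩)
    · exact Or.inl (Or.inr ⟨⟨p1, p2⟩, i, hi, Or.inr hp⟩)

theorem im_inter {E : Emb m n} {α β : Fin m → ℝ} (h : Adm E α β) {j : Fin m} {s : Finset (Fin m)}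
    (hj : j ∉ s) : E.φ '' M1 E α β j s ∩ E.φ '' M2 E α β j s = E.φ '' Pb E.A E.B α β s := by
  rw [← E.inj.image_inter (good_M1 h hj).1 (good_M2 h hj).1, M_inter h]

theorem im_union {E : Emb m n} {α β : Fin m → ℝ} (h : Adm E α β) (j : Fin m) (s : Finset (Fin m)) :
    E.φ '' M1 E α β j s ∪ E.φ '' M2 E α β j s = E.φ '' Pb E.A E.B α β (insert j s) := by
  rw [← Set.image_union, M_union h]

theorem rank0 (z : Sq n) (N₀ : ℕ) (hz : ∀ N ≥ N₀, z (N + 1) = sd (z N) ∧ bd (z N) = 0)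
    (h0 : z N₀ (fun _ => 1) = 0) : Bd ∅ z := by
  have h2 : (0 : ℝ) < 2 ^ N₀ := by positivity
  refine (acyc_point (fun _ : Fin n => (1 / 2 : ℝ) / 2 ^ N₀) z ⟨?_, ?_, ?_⟩).mono (Set.empty_subset _)
  · exact eventually_atTop.2 ⟨N₀, fun N hN => (hz N hN).1⟩
  · exact eventually_atTop.2 ⟨N₀, fun N hN => (hz N hN).2⟩
  · refine eventually_atTop.2 ⟨N₀, avoids_level (fun N hN => (hz N hN).1) ?_⟩
    intro a ha
    rw [Set.disjoint_singleton_right]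
    intro hp
    apply ha
    convert h0 using 2
    funext i
    have h3 := hp i
    rw [div_mul_cancel₀ _ h2.ne'] at h3
    have h4 : ((a i / 2 : ℤ) : ℝ) < ((1 : ℤ) : ℝ) := by push_cast; linarith
    have h5 : ((0 : ℤ) : ℝ) < (((a i + 1) / 2 : ℤ) : ℝ) := by push_cast; linarith
    have h4' := Int.cast_lt.1 h4
    have h5' := Int.cast_lt.1 h5
    omega

theorem zmod2_cases (a : ZMod 2) : a = 0 ∨ a = 1 := by revert a; decide

theorem rank_le {E : Emb m n} {α β : Fin m → ℝ} (h : Adm E α β) (s : Finset (Fin m)) :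
    ∀ z w : Sq n, Zc (E.φ '' Pb E.A E.B α β s) z → Zc (E.φ '' Pb E.A E.B α β s) w →
    Bd (E.φ '' Pb E.A E.B α β s) z ∨ Bd (E.φ '' Pb E.A E.B α β s) w ∨
      Bd (E.φ '' Pb E.A E.B α β s) (z + w) := by
  induction s using Finset.induction_on with
  | empty =>
    intro z w hz hw
    have : Pb E.A E.B α β ∅ = ∅ := by ext; simp [Pb]
    rw [this, Set.image_empty] at *
    obtain ⟨N₀, hN₀⟩ := eventually_atTop.1 ((hz.1.and hz.2).and (hw.1.and hw.2))
    rcases zmod2_cases (z N₀ fun _ => 1) with h1 | h1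
    · exact Or.inl (rank0 z N₀ (fun N hN => (hN₀ N hN).1) h1)
    rcases zmod2_cases (w N₀ fun _ => 1) with h2 | h2
    · exact Or.inr (Or.inl (rank0 w N₀ (fun N hN => (hN₀ N hN).2) h2))
    refine Or.inr (Or.inr (rank0 (z + w) N₀ (fun N hN => ?_) ?_))
    · obtain ⟨⟨p1, p2⟩, p3, p4⟩ := hN₀ N hN
      simp only [Pi.add_apply, p1, p3, map_add, p2, p4, add_zero, and_self]
    · simp only [Pi.add_apply, h1, h2]; decide
  | insert j s hj ih =>
    intro z w hz hw
    rw [← im_union h] at *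
    have G1 := good_M1 h hj
    have G2 := good_M2 h hj
    have c1 := E.compact G1.1 G1.2
    have c2 := E.compact G2.1 G2.2
    have key : ∀ z, Zc (E.φ '' M1 E α β j s ∪ E.φ '' M2 E α β j s) z → ∃ a b : Sq n, IsC a ∧
        Av (E.φ '' M1 E α β j s) a ∧ Av (E.φ '' M2 E α β j s) b ∧
        (∀ᶠ N in atTop, bd (a N) = z N) ∧ Zc (E.φ '' Pb E.A E.B α β s) (a + b) := by
      intro z hz
      obtain ⟨a, ha1, ha2, ha3⟩ := G1.3 z (hz.mono Set.subset_union_left)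
      obtain ⟨b, hb1, hb2, hb3⟩ := G2.3 z (hz.mono Set.subset_union_right)
      refine ⟨a, b, ha1, ha2, hb2, ha3, ha1.add hb1, ?_, ?_⟩
      · filter_upwards [ha3, hb3] with N e1 e2
        simp only [Pi.add_apply, map_add, e1, e2]; exact ch_add_self _
      · rw [← im_inter h hj]
        exact (ha2.mono Set.inter_subset_left).add (hb2.mono Set.inter_subset_right)
    obtain ⟨a, b, p1, p2, p3, p4, p5⟩ := key z hz
    obtain ⟨a', b', q1, q2, q3, q4, q5⟩ := key w hw
    rcases ih _ _ p5 q5 with h' | h' | h' <;> rw [← im_inter h hj] at h'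
    · exact Or.inl (mv_glue c1 c2 p1 p2 p3 p4 h')
    · exact Or.inr (Or.inl (mv_glue c1 c2 q1 q2 q3 q4 h'))
    · refine Or.inr (Or.inr (mv_glue c1 c2 (a := a + a') (b := b + b') (p1.add q1) (p2.add q2)
        (p3.add q3) ?_ ?_))
      · filter_upwards [p4, q4] with N e1 e2
        simp only [Pi.add_apply, map_add, e1, e2]
      · convert h' using 1
        abel

/-- fundamental chain -/
def fund (n : ℕ) : Ch n := fun a => if ∀ i, Odd (a i) then 1 else 0

theorem fund_hm : Hm n (fund n) := by
  intro a ha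
  simp only [fund, ne_eq, ite_eq_right_iff, not_forall] at ha
  obtain ⟨h, -⟩ := ha
  rw [Finset.filter_true_of_mem (fun i _ => h i)]; simp

theorem fund_sd : sd (fund n) = fund n := by
  funext b
  rw [sd_apply]
  simp only [fund]
  by_cases h : ∀ i, Odd (b i)
  · rw [if_pos h, if_pos, if_pos]
    · intro i
      obtain ⟨k, hk⟩ := h i
      rw [Int.odd_iff]
      simp only [par]; omega
    · intro i
      obtain ⟨k, hk⟩ := h i
      omega
  · rw [if_neg h]
    split_ifs with h1 h2
    · exfalso; apply h
      intro i
      have := h2 i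
      rw [Int.odd_iff] at this ⊢
      simp only [par] at this; omega
    · rfl
    · rfl

theorem fund_bd : bd (fund n) = 0 := by
  funext a
  rw [bd_apply]
  apply Finset.sum_eq_zero
  intro i _
  rw [D_apply]
  split_ifs with h
  · have : fund n (Function.update a i (a i + 1)) = fund n (Function.update a i (a i - 1)) := by
      simp only [fund]
      congr 1
      apply propext
      apply forall_congr'
      intro k
      by_cases hk : k = i
      · subst hk
        simp only [Function.update_self]
        rw [Int.odd_iff, Int.odd_iff]; omega
      · simp only [Function.update_of_ne hk]
    rw [this]
    exact CharTwo.add_self_eq_zero _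
  · rfl

theorem fund_not_bd : ¬ Bd (n := n) ∅ (fun _ => fund n) := by
  rintro ⟨c, -, -, h⟩
  obtain ⟨N, hN⟩ := h.exists
  have := congrFun hN (fun _ => 1)
  rw [bd_apply] at this
  simp [D_apply, fund] at this

theorem exists_class {E : Emb m n} {α β : Fin m → ℝ} (h : Adm E α β) (h' : Adm E E.A E.B)
    (s : Finset (Fin m)) : ∀ d, d + s.card = n → ∃ z : Sq n,
      Zc (E.φ '' Pb E.A E.B α β s) z ∧ HmS d z ∧ ¬ Bd (E.φ '' Pb E.A E.B E.A E.B s) z := by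
  induction s using Finset.induction_on with
  | empty =>
    intro d hd
    simp only [Finset.card_empty, add_zero] at hd
    subst hd
    have : ∀ α β, Pb E.A E.B α β ∅ = ∅ := by intro α β; ext; simp [Pb]
    simp only [this, Set.image_empty]
    refine ⟨fun _ => fund d, ⟨?_, ?_, ?_⟩, ?_, fund_not_bd⟩
    · exact Eventually.of_forall fun _ => fund_sd.symm
    · exact Eventually.of_forall fun _ => fund_bd
    · exact Eventually.of_forall fun _ _ _ => Set.disjoint_empty _
    · exact Eventually.of_forall fun _ => fund_hm
  | insert j s hj ih =>
    intro d hd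
    rw [Finset.card_insert_of_notMem hj] at hd
    obtain ⟨z, hz, hzd, hzb⟩ := ih (d + 1) (by omega)
    have G1 := good_M1 h hj
    have G2 := good_M2 h hj
    have c1 := E.compact G1.1 G1.2
    have c2 := E.compact G2.1 G2.2
    have F1 := good_M1 h' hj
    have F2 := good_M2 h' hj
    have hPs : Pb E.A E.B E.A E.B s ⊆ Pb E.A E.B α β s := by
      rintro t ⟨ht, i, hi, hp⟩
      refine ⟨ht, i, hi, ?_⟩
      have := h i
      rcases hp with hp | hp
      · exact Or.inl (by linarith)
      · exact Or.inr (by linarith)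
    have s1 : E.φ '' M1 E E.A E.B j s ⊆ E.φ '' M1 E α β j s :=
      Set.image_mono (Set.union_subset_union (Set.Icc_subset_Icc
        (update_le_update_iff.2 ⟨(h j).2.2, fun _ _ => le_rfl⟩) le_rfl) hPs)
    have s2 : E.φ '' M2 E E.A E.B j s ⊆ E.φ '' M2 E α β j s :=
      Set.image_mono (Set.union_subset_union (Set.Icc_subset_Icc le_rfl
        (update_le_update_iff.2 ⟨(h j).1, fun _ _ => le_rfl⟩)) hPs)
    obtain ⟨z1, z2, i1, i2, a1, a2, hzz, hh⟩ := split hz.1 c1 c2.isClosed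
      (by rw [im_inter h hj]; exact hz.3) (d + 1)
    obtain ⟨hh1, hh2⟩ := hh hzd
    have heq : ∀ᶠ N in atTop, bd (z2 N) = bd (z1 N) := by
      filter_upwards [hzz, hz.2] with N e1 e2
      rw [e1, map_add] at e2
      have := sq_cancel _ _ _ e2
      rw [this, zero_add]
    refine ⟨fun N => bd (z1 N), ?_, ?_, ?_⟩
    · rw [← im_union h]
      refine ⟨i1.bd, Eventually.of_forall fun N => bd_bd _, a1.bd.union ?_⟩
      filter_upwards [heq, a2.bd] with N e1 e2
      rw [← e1]; exact e2
    · filter_upwards [hh1] with N e using e.bd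
    · rw [← im_union h']
      rintro ⟨c, hc1, hc2, hc3⟩
      apply hzb
      have b1 : Bd (E.φ '' M1 E E.A E.B j s) (z1 + c) := by
        apply F1.3 _ ⟨i1.add hc1, ?_, (a1.mono s1).add (hc2.mono Set.subset_union_left)⟩
        filter_upwards [hc3] with N e
        simp only [Pi.add_apply, map_add, e]; exact ch_add_self _
      have b2 : Bd (E.φ '' M2 E E.A E.B j s) (z2 + c) := by
        apply F2.3 _ ⟨i2.add hc1, ?_, (a2.mono s2).add (hc2.mono Set.subset_union_right)⟩
        filter_upwards [hc3, heq] with N e e'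
        simp only [Pi.add_apply, map_add, e, e']; exact ch_add_self _
      rw [← im_inter h' hj]
      refine ((b1.mono Set.inter_subset_left).add (b2.mono Set.inter_subset_right)).congr ?_
      filter_upwards [hzz] with N e
      simp only [Pi.add_apply, e]
      rw [add_add_add_comm, ch_add_self, add_zero]

end LJB


namespace LJB
open Filter Topology

variable {n m : ℕ}

theorem in_ball_iff (N : ℕ) (a : Fin n → ℤ) (x : Fin n → ℝ) {r : ℝ} (hr : 0 < r) :
    Disjoint (cell N a) (Metric.ball x r)ᶜ ↔
      (fun i => 2 * ⌊(x i - r) * 2 ^ N⌋ + 2) ≤ a ∧ a ≤ (fun i => 2 * ⌈(x i + r) * 2 ^ N⌉ - 2) := by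
  have h2 : (0 : ℝ) < 2 ^ N := by positivity
  have key : Disjoint (cell N a) (Metric.ball x r)ᶜ ↔ ∀ i, (x i - r) * 2 ^ N < ((a i / 2 : ℤ) : ℝ) ∧
      (((a i + 1) / 2 : ℤ) : ℝ) < (x i + r) * 2 ^ N := by
    rw [Set.disjoint_compl_right_iff_subset]
    constructor
    · intro h i
      have hle := Set.nonempty_Icc.1 (by rw [← cell_eq_Icc]; exact cell_nonempty N a)
      have e1 := h (by rw [cell_eq_Icc]; exact Set.left_mem_Icc.2 hle)
      have e2 := h (by rw [cell_eq_Icc]; exact Set.right_mem_Icc.2 hle)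
      rw [Metric.mem_ball, dist_pi_lt_iff hr] at e1 e2
      have e1 := e1 i
      have e2 := e2 i
      rw [Real.dist_eq, abs_lt] at e1 e2
      constructor
      · rw [← lt_div_iff₀ h2]; linarith
      · rw [← div_lt_iff₀ h2]; linarith
    · intro h y hy
      rw [Metric.mem_ball, dist_pi_lt_iff hr]
      intro i
      obtain ⟨h3, h4⟩ := h i
      obtain ⟨h5, h6⟩ := hy i
      have h7 := lt_of_mul_lt_mul_right (lt_of_lt_of_le h3 h5) h2.le
      have h8 := lt_of_mul_lt_mul_right (lt_of_le_of_lt h6 h4) h2.le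
      rw [Real.dist_eq, abs_lt]
      constructor <;> linarith
  rw [key, Pi.le_def, Pi.le_def, ← forall_and]
  apply forall_congr'
  intro i
  rw [← Int.floor_lt, ← Int.lt_ceil]
  constructor
  · rintro ⟨h3, h4⟩; constructor <;> omega
  · rintro ⟨h3, h4⟩; constructor <;> omega

theorem box_bd {x : Fin n → ℝ} {r : ℝ} (hr : 0 < r) {z : Sq n} (hz : Zc (Metric.ball x r)ᶜ z)
    (haug : ∀ᶠ N in atTop, aug (z N) = 0) : Bd (Metric.ball x r)ᶜ z := by
  obtain ⟨N, hN⟩ := eventually_atTop.1 (hz.1.and (hz.2.and (hz.3.and haug)))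
  obtain ⟨-, h2, h3, h4⟩ := hN N le_rfl
  obtain ⟨e, he, hb⟩ := box_acyclic (fun i => 2 * ⌊(x i - r) * 2 ^ N⌋ + 2)
    (fun i => 2 * ⌈(x i + r) * 2 ^ N⌉ - 2) (fun i => by simp)
    (fun i => by simp) (z N) h2 (fun a ha => (in_ball_iff N a x hr).1 (h3 a ha)) h4
  exact Bd_of_level (fun M hM => (hN M hM).1) e he fun a ha => (in_ball_iff N a x hr).2 (hb a ha)

theorem fin_supp {N : ℕ} {c : Ch n} {U : Set (Fin n → ℝ)} (hU : Bornology.IsBounded U)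
    (h : Avoids N c Uᶜ) : (Function.support c).Finite := by
  apply (cells_finite N U hU).subset
  intro a ha
  have h1 := Set.disjoint_compl_right_iff_subset.1 (h a ha)
  obtain ⟨x, hx⟩ := cell_nonempty N a
  exact ⟨x, hx, h1 hx⟩

/-- dyadic points of level N -/
def Dy (N : ℕ) (x : Fin n → ℝ) : Prop := ∀ i, ∃ k : ℤ, x i * 2 ^ N = k

theorem Dy.succ {N : ℕ} {x : Fin n → ℝ} (h : Dy N x) : Dy (N + 1) x := by
  intro i
  obtain ⟨k, hk⟩ := h i
  exact ⟨2 * k, by rw [pow_succ, ← mul_assoc, hk]; push_cast; ring⟩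

theorem Dy.le {N M : ℕ} {x : Fin n → ℝ} (h : Dy N x) (hM : N ≤ M) : Dy M x := by
  induction M, hM using Nat.le_induction with
  | base => exact h
  | succ M _ ih => exact ih.succ

/-- point chain -/
noncomputable def pc (x : Fin n → ℝ) : Sq n := by
  classical exact fun N a => if ∀ i, Even (a i) ∧ (a i : ℝ) = 2 * (x i * 2 ^ N) then 1 else 0

theorem pc_ne {x : Fin n → ℝ} {N : ℕ} {a : Fin n → ℤ} (h : pc x N a ≠ 0) :
    ∀ i, Even (a i) ∧ (a i : ℝ) = 2 * (x i * 2 ^ N) := by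
  by_contra h'
  exact h (if_neg h')

theorem pc_cell {x : Fin n → ℝ} {N : ℕ} {a : Fin n → ℤ}
    (h : ∀ i, Even (a i) ∧ (a i : ℝ) = 2 * (x i * 2 ^ N)) : cell N a = {x} := by
  have h2 : (0 : ℝ) < 2 ^ N := by positivity
  ext y
  rw [Set.mem_singleton_iff]
  have e : ∀ i, ((a i / 2 : ℤ) : ℝ) = x i * 2 ^ N ∧ (((a i + 1) / 2 : ℤ) : ℝ) = x i * 2 ^ N := by
    intro i
    obtain ⟨⟨k, hk⟩, h3⟩ := h i
    have e1 : a i / 2 = k := by omega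
    have e2 : (a i + 1) / 2 = k := by omega
    rw [e1, e2]
    rw [hk] at h3; push_cast at h3
    constructor <;> linarith
  constructor
  · intro hy
    funext i
    obtain ⟨h5, h6⟩ := hy i
    rw [(e i).1] at h5
    rw [(e i).2] at h6
    exact mul_right_cancel₀ h2.ne' (le_antisymm h6 h5)
  · rintro rfl i
    exact ⟨(e i).1.le, (e i).2.ge⟩

theorem pc_avoids {x : Fin n → ℝ} (N : ℕ) {K} (hx : x ∉ K) : Avoids N (pc x N) K := by
  intro a ha
  rw [pc_cell (pc_ne ha)]
  exact Set.disjoint_singleton_left.2 hx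

theorem pc_sd {x : Fin n → ℝ} {N : ℕ} (h : Dy N x) : pc x (N + 1) = sd (pc x N) := by
  funext b
  choose k hk using h
  rw [sd_apply]
  simp only [pc]
  have h1 : (∀ i, Even (b i) ∧ (b i : ℝ) = 2 * (x i * 2 ^ (N + 1))) ↔ ∀ i, b i = 4 * k i := by
    apply forall_congr'; intro i
    rw [pow_succ, ← mul_assoc (x i), hk]
    constructor
    · rintro ⟨_, h⟩
      have : (b i : ℝ) = ((4 * k i : ℤ) : ℝ) := by rw [h]; push_cast; ring
      exact_mod_cast this
    · intro h
      refine ⟨⟨2 * k i, by omega⟩, ?_⟩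
      rw [h]; push_cast; ring
  have h3 : (∀ i, Even (par (b i)) ∧ ((par (b i) : ℤ) : ℝ) = 2 * (x i * 2 ^ N)) ↔
      ∀ i, par (b i) = 2 * k i := by
    apply forall_congr'; intro i
    rw [hk]
    constructor
    · rintro ⟨_, h⟩
      exact_mod_cast h
    · intro h
      refine ⟨⟨k i, by omega⟩, ?_⟩
      rw [h]; push_cast; ring
  simp only [h1, h3]
  by_cases hb : ∀ i, b i = 4 * k i
  · rw [if_pos hb, if_pos, if_pos]
    · intro i; rw [hb i, par]; omega
    · intro i; rw [hb i]; omega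
  · rw [if_neg hb]
    split_ifs with p1 p2
    · exfalso; apply hb; intro i
      have := p1 i
      have := p2 i
      rw [par] at this
      omega
    · rfl
    · rfl

theorem pc_isC {x : Fin n → ℝ} {N : ℕ} (h : Dy N x) : IsC (pc x) :=
  eventually_atTop.2 ⟨N, fun _ hM => pc_sd (h.le hM)⟩

theorem bd_zero_cells {c : Ch n} (h : ∀ a, c a ≠ 0 → ∀ i, Even (a i)) : bd c = 0 := by
  funext a
  rw [bd_apply]
  apply Finset.sum_eq_zero
  intro i _
  rw [D_apply]
  split_ifs with hi
  · have : ∀ v : ℤ, Odd v → c (Function.update a i v) = 0 := by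
      intro v hv
      by_contra h0
      have := h _ h0 i
      rw [Function.update_self] at this
      exact (Int.not_even_iff_odd.2 hv) this
    rw [this _ hi.add_one, this _ (hi.sub_odd odd_one), add_zero]
  · rfl

theorem pc_bd (x : Fin n → ℝ) (N : ℕ) : bd (pc x N) = 0 := bd_zero_cells fun _ ha i => (pc_ne ha i).1

theorem pc_supp (x : Fin n → ℝ) (N : ℕ) : (Function.support (pc x N)).Finite :=
  fin_supp (U := {x}) Bornology.isBounded_singleton (pc_avoids N (by simp))

theorem pc_aug {x : Fin n → ℝ} {N : ℕ} (h : Dy N x) : aug (pc x N) = 1 := by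
  choose k hk using h
  unfold aug
  rw [finsum_eq_single _ k]
  · simp only [pc]
    rw [if_pos]
    intro i
    refine ⟨even_two_mul _, ?_⟩
    rw [hk]; push_cast; ring
  · intro v hv
    by_contra h0
    apply hv
    funext i
    have := (pc_ne h0 i).2
    rw [hk] at this
    have : 2 * v i = 2 * k i := by exact_mod_cast this
    omega

theorem exists_dy (u : Fin n → ℝ) {ε : ℝ} (hε : 0 < ε) : ∃ p N, Dy N p ∧ p ∈ Metric.ball u ε := by
  obtain ⟨N, -, hN⟩ := exists_mesh hε 0
  have h2 : (0 : ℝ) < 2 ^ N := by positivity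
  refine ⟨fun i => (⌊u i * 2 ^ N⌋ : ℝ) / 2 ^ N, N, fun i => ⟨⌊u i * 2 ^ N⌋, ?_⟩, ?_⟩
  · exact div_mul_cancel₀ _ h2.ne'
  · rw [Metric.mem_ball]
    refine lt_of_le_of_lt ?_ hN
    rw [dist_pi_le_iff (by positivity)]
    intro i
    have h3 := Int.floor_le (u i * 2 ^ N)
    have h4 := Int.lt_floor_add_one (u i * 2 ^ N)
    rw [Real.dist_eq, abs_le, ← neg_div, div_le_iff₀ h2, le_div_iff₀ h2, sub_mul,
          div_mul_cancel₀ _ h2.ne']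
    constructor <;> linarith

/-- dyadic points -/
def Dya (x : Fin n → ℝ) : Prop := ∃ N, Dy N x

/-- homologous points -/
def Jn (U : Set (Fin n → ℝ)) (p q : Fin n → ℝ) : Prop := Bd Uᶜ (pc p + pc q)

theorem Jn.trans {U : Set (Fin n → ℝ)} {p q s : Fin n → ℝ} (h : Jn U p q) (h' : Jn U q s) :
    Jn U p s := by
  refine (Bd.add h h').congr (Eventually.of_forall fun N => ?_)
  simp only [Pi.add_apply]
  rw [add_assoc, ← add_assoc (pc q N), ch_add_self, zero_add]

theorem Jn.symm {U : Set (Fin n → ℝ)} {p q : Fin n → ℝ} (h : Jn U p q) : Jn U q p := by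
  unfold Jn at *; rwa [add_comm]

theorem Jn.mono {U V : Set (Fin n → ℝ)} {p q : Fin n → ℝ} (h : Jn U p q) (hUV : U ⊆ V) : Jn V p q :=
  Bd.mono h (Set.compl_subset_compl.2 hUV)

theorem pc_zc {U : Set (Fin n → ℝ)} {p : Fin n → ℝ} (hp : Dya p) (hpU : p ∈ U) : Zc Uᶜ (pc p) := by
  obtain ⟨N, h⟩ := hp
  exact ⟨pc_isC h, Eventually.of_forall fun N => pc_bd _ _,
    Eventually.of_forall fun N => pc_avoids N (by simpa using hpU)⟩

theorem Dya.ev {p : Fin n → ℝ} (hp : Dya p) : ∀ᶠ N in atTop, Dy N p := by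
  obtain ⟨N, h⟩ := hp
  exact eventually_atTop.2 ⟨N, fun _ hM => h.le hM⟩

theorem Jn_ball {u : Fin n → ℝ} {r : ℝ} {p q : Fin n → ℝ} (hp : Dya p) (hq : Dya q)
    (h : p ∈ Metric.ball u r) (h' : q ∈ Metric.ball u r) : Jn (Metric.ball u r) p q := by
  have hr : 0 < r := Metric.pos_of_mem_ball h
  apply box_bd hr ((pc_zc hp h).add (pc_zc hq h'))
  filter_upwards [hp.ev, hq.ev] with N h1 h2
  simp only [Pi.add_apply]
  rw [aug_add (pc_supp _ _) (pc_supp _ _), pc_aug h1, pc_aug h2]; decide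

theorem join {U T : Set (Fin n → ℝ)} (hU : IsOpen U) (hT : IsPreconnected T) (hTU : T ⊆ U)
    {p q : Fin n → ℝ} (hp : Dya p) (hq : Dya q) (hpT : p ∈ T) (hqT : q ∈ T) : Jn U p q := by
  have := hT.induction₂ (fun u v => ∃ ε > 0, ∀ p ∈ Metric.ball u ε, ∀ q ∈ Metric.ball v ε,
    Dya p → Dya q → Jn U p q) (by
      intro u hu
      obtain ⟨ε, hε, hb⟩ := Metric.isOpen_iff.1 hU u (hTU hu)
      filter_upwards [nhdsWithin_le_nhds (Metric.ball_mem_nhds u (half_pos hε))] with v hv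
      refine ⟨ε / 2, half_pos hε, fun p hp q hq hp' hq' => ?_⟩
      refine (Jn_ball hp' hq' (u := u) (r := ε) ?_ ?_).mono hb
      · exact Metric.ball_subset_ball (by linarith) hp
      · rw [Metric.mem_ball] at *
        linarith [dist_triangle q v u]) (by
      rintro u v w - - - ⟨ε, hε, h1⟩ ⟨δ, hδ, h2⟩
      obtain ⟨s, N, hs, hsb⟩ := exists_dy v (lt_min hε hδ)
      refine ⟨min ε δ, lt_min hε hδ, fun p hp q hq hp' hq' => ?_⟩
      exact (h1 p (Metric.ball_subset_ball (min_le_left _ _) hp) s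
        (Metric.ball_subset_ball (min_le_left _ _) hsb) hp' ⟨N, hs⟩).trans
        (h2 s (Metric.ball_subset_ball (min_le_right _ _) hsb) q
        (Metric.ball_subset_ball (min_le_right _ _) hq) ⟨N, hs⟩ hq')) (by
      rintro u v - - ⟨ε, hε, h1⟩
      exact ⟨ε, hε, fun p hp q hq hp' hq' => (h1 q hq p hp hq' hp').symm⟩) hpT hqT
  obtain ⟨ε, hε, h⟩ := this
  exact h p (Metric.mem_ball_self hε) q (Metric.mem_ball_self hε) hp hq

/-- connected within U -/
def Cn {X : Type*} [TopologicalSpace X] (U : Set X) (p q : X) : Prop :=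
  ∃ T ⊆ U, IsPreconnected T ∧ p ∈ T ∧ q ∈ T

theorem conn_of_chain {U : Set (Fin n → ℝ)} (hUb : Bornology.IsBounded U) {p q : Fin n → ℝ} {M : ℕ}
    (hp : Dy M p) (hpU : p ∈ U) (f : Ch n) (hf : Avoids M f Uᶜ)
    (hb : bd f = pc p M + pc q M) : Cn U p q := by
  refine ⟨connectedComponentIn U p, connectedComponentIn_subset _ _,
    isPreconnected_connectedComponentIn, mem_connectedComponentIn hpU, ?_⟩
  classical
  by_contra hq
  set T := connectedComponentIn U p with hT
  let P : (Fin n → ℤ) → Prop := fun a => (cell M a ∩ T).Nonempty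
  have hsub : ∀ a, cell M a ⊆ U → P a → cell M a ⊆ T := by
    rintro a ha ⟨x, hx, hxT⟩
    have := (cell_convex M a).isPreconnected.subset_connectedComponentIn hx ha
    rw [hT, connectedComponentIn_eq hxT]; exact this
  have h1 : bd (rs P f) = rs P (bd f) := by
    funext a
    have key : ∀ i, Even (a i) → ∀ v, (v = a i + 1 ∨ v = a i - 1) →
        rs P f (Function.update a i v) = if P a then f (Function.update a i v) else 0 := by
      intro i hi v hv
      by_cases h0 : f (Function.update a i v) = 0
      · rw [h0, ite_self]
        by_contra h'
        exact (rs_ne h').2 h0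
      have hc := Set.disjoint_compl_right_iff_subset.1 (hf _ h0)
      have hcu := cell_update M a i hi v hv
      by_cases hPa : P a
      · rw [if_pos hPa, rs_apply_pos]
        exact hPa.mono (Set.inter_subset_inter_left _ hcu)
      · rw [if_neg hPa, rs_apply_neg]
        intro h'
        apply hPa
        obtain ⟨x, hx⟩ := cell_nonempty M a
        exact ⟨x, hx, hsub _ hc h' (hcu hx)⟩
    rw [bd_apply]
    by_cases hPa : P a
    · rw [rs_apply_pos hPa, bd_apply]
      apply Finset.sum_congr rfl
      intro i _
      rw [D_apply, D_apply]
      by_cases hi : Even (a i)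
      · rw [if_pos hi, if_pos hi, key i hi _ (Or.inl rfl), key i hi _ (Or.inr rfl), if_pos hPa,
          if_pos hPa]
      · rw [if_neg hi, if_neg hi]
    · rw [rs_apply_neg hPa]
      apply Finset.sum_eq_zero
      intro i _
      rw [D_apply]
      by_cases hi : Even (a i)
      · rw [if_pos hi, key i hi _ (Or.inl rfl), key i hi _ (Or.inr rfl), if_neg hPa,
          if_neg hPa, add_zero]
      · rw [if_neg hi]
  have h2 : rs P (bd f) = pc p M := by
    rw [hb]
    funext a
    by_cases hPa : P a
    · rw [rs_apply_pos hPa, Pi.add_apply]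
      have : pc q M a = 0 := by
        by_contra h0
        obtain ⟨x, hx, hxT⟩ := hPa
        rw [pc_cell (pc_ne h0)] at hx
        rw [Set.mem_singleton_iff.1 hx] at hxT
        exact hq hxT
      rw [this, add_zero]
    · rw [rs_apply_neg hPa]
      by_contra h0
      apply hPa
      refine ⟨p, ?_, mem_connectedComponentIn hpU⟩
      rw [pc_cell (pc_ne (Ne.symm h0))]; rfl
  have h3 := aug_bd (fin_supp hUb (hf.rs P))
  rw [h1, h2, pc_aug hp] at h3
  exact one_ne_zero h3

end LJB


namespace LJB
open Filter Topology

variable {n m : ℕ}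

/-- interior points of the box -/
def Emb.Int (E : Emb m n) (t : Fin m → ℝ) : Prop := ∀ i, E.A i < t i ∧ t i < E.B i

/-- image of the closed box -/
def Emb.D (E : Emb m n) : Set (Fin n → ℝ) := E.φ '' Set.Icc E.A E.B

theorem Emb.Int.mem {E : Emb m n} {t} (h : E.Int t) : t ∈ Set.Icc E.A E.B :=
  ⟨fun i => (h i).1.le, fun i => (h i).2.le⟩

theorem Emb.Int.adm {E : Emb m n} {t} (h : E.Int t) : Adm E E.A E.B := fun i =>
  ⟨le_rfl, (h i).1.trans (h i).2, le_rfl⟩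

theorem Emb.D_compact (E : Emb m n) : IsCompact E.D := E.compact le_rfl isClosed_Icc

theorem Emb.D_acyc {E : Emb m n} {t} (h : E.Int t) : Acyc E.D := (good_Icc h.adm.le le_rfl).3

theorem slab_choice {E : Emb m n} {t} (h : E.Int t) {O : Set (Fin n → ℝ)} (hO : IsOpen O)
    (htO : E.φ t ∈ O) : ∃ α β, Adm E α β ∧ E.φ t ∉ E.φ '' Pb E.A E.B α β Finset.univ ∧
      E.D ∩ Oᶜ ⊆ E.φ '' Pb E.A E.B α β Finset.univ := by
  have h1 := E.cont t h.mem (hO.mem_nhds htO)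
  rw [Filter.mem_map, Metric.mem_nhdsWithin_iff] at h1
  obtain ⟨ε, hε, hb⟩ := h1
  refine ⟨fun i => max (E.A i) (t i - ε), fun i => min (E.B i) (t i + ε), ?_, ?_, ?_⟩
  · intro i
    refine ⟨le_max_left _ _, ?_, min_le_left _ _⟩
    have := h i
    rw [max_lt_iff, lt_min_iff, lt_min_iff]
    refine ⟨⟨?_, ?_⟩, ?_, ?_⟩ <;> linarith
  · rintro ⟨t', ht', he⟩
    have := E.inj ht'.1 h.mem he
    subst this
    obtain ⟨-, i, -, hi⟩ := ht'
    have := h i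
    rw [min_le_iff, le_max_iff] at hi
    rcases hi with (hi | hi) | (hi | hi) <;> linarith
  · rintro _ ⟨⟨t', ht', rfl⟩, hn⟩
    refine ⟨t', ⟨ht', ?_⟩, rfl⟩
    by_contra hc
    push Not at hc
    apply hn
    apply hb
    refine ⟨?_, ht'⟩
    rw [Metric.mem_ball, dist_pi_lt_iff hε]
    intro i
    obtain ⟨c1, c2⟩ := hc i (Finset.mem_univ i)
    rw [lt_min_iff] at c1
    rw [max_lt_iff] at c2
    rw [Real.dist_eq, abs_lt]
    constructor <;> linarith [c1.2, c2.2]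

theorem Cn.trans {X : Type*} [TopologicalSpace X] {U : Set X} {p q s : X} (h : Cn U p q)
    (h' : Cn U q s) : Cn U p s := by
  obtain ⟨T, hT, h1, h2, h3⟩ := h
  obtain ⟨T', hT', h1', h2', h3'⟩ := h'
  exact ⟨T ∪ T', Set.union_subset hT hT', h1.union q h3 h2' h1', Or.inl h2, Or.inr h3'⟩

theorem Cn.symm {X : Type*} [TopologicalSpace X] {U : Set X} {p q : X} (h : Cn U p q) :
    Cn U q p := by
  obtain ⟨T, hT, h1, h2, h3⟩ := h
  exact ⟨T, hT, h1, h3, h2⟩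

theorem b_core {D O A' : Set (Fin n → ℝ)} (hD : IsCompact D) (hO : IsOpen O)
    (hOb : Bornology.IsBounded O) (hA : D ∩ Oᶜ ⊆ A') {p q : Fin n → ℝ} (hp : Dya p)
    (hpU : p ∈ O \ D) {a g : Sq n} (ha : Av D a) (hg : Av Oᶜ g)
    (hgb : ∀ᶠ N in atTop, bd (g N) = pc p N + pc q N)
    (hb : Bd A' (a + g)) : Cn (O \ D) p q := by
  obtain ⟨e, he1, he2, he3⟩ := hb
  obtain ⟨e1, e2, i1, i2, v1, v2, hee, -⟩ := split he1 hD hO.isClosed_compl (he2.mono hA) 0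
  obtain ⟨N, k1, k2, k3, k4, k5, k6, k7⟩ := (v1.and (v2.and (ha.and (hg.and (hgb.and
    (hee.and (he3.and hp.ev))))))).exists
  obtain ⟨k7, k8⟩ := k7
  refine conn_of_chain (hOb.subset Set.sdiff_subset) k8 hpU (g N + bd (e2 N)) ?_ ?_
  · have hc : (O \ D)ᶜ = D ∪ Oᶜ := by
      ext x; simp only [Set.mem_compl_iff, Set.mem_sdiff, Set.mem_union]; tauto
    rw [hc]
    refine Avoids.union ?_ (k4.add k2.bd)
    have : g N + bd (e2 N) = a N + bd (e1 N) := by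
      rw [k6, map_add, Pi.add_apply] at k7
      have := sq_cancel _ _ _ k7
      rw [this, add_assoc (a N), ← add_assoc, ch_add_self, zero_add]
    rw [this]
    exact k3.add k1.bd
  · rw [map_add, bd_bd, k5, add_zero]

theorem partB {E : Emb m n} {t} (h : E.Int t) {O : Set (Fin n → ℝ)} (hO : IsOpen O)
    (hOb : Bornology.IsBounded O) (htO : E.φ t ∈ O) : ∃ r > 0, Metric.ball (E.φ t) r ⊆ O ∧
      ∀ p ∈ Metric.ball (E.φ t) r \ E.D, ∀ q ∈ Metric.ball (E.φ t) r \ E.D,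
      ∀ s ∈ Metric.ball (E.φ t) r \ E.D, Cn (O \ E.D) p q ∨ Cn (O \ E.D) q s ∨ Cn (O \ E.D) p s := by
  obtain ⟨α, β, hadm, htn, hsub⟩ := slab_choice h hO htO
  set A' := E.φ '' Pb E.A E.B α β Finset.univ with hA'
  have hA'D : A' ⊆ E.D := Set.image_mono (Pb_sub _ _ _ _ _)
  have hA'c : IsClosed A' := (E.compact (Pb_sub _ _ _ _ _) (Pb_closed _ _ _ _ _)).isClosed
  obtain ⟨r, hr, hball⟩ := Metric.isOpen_iff.1 (hO.inter hA'c.isOpen_compl) (E.φ t) ⟨htO, htn⟩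
  refine ⟨r, hr, fun x hx => (hball hx).1, ?_⟩
  set O₂ := Metric.ball (E.φ t) r with hO₂
  have hO₂O : O₂ ⊆ O := fun x hx => (hball hx).1
  have hO₂A : A' ⊆ O₂ᶜ := fun x hx hx' => (hball hx').2 hx
  -- dyadic version
  have key : ∀ p ∈ O₂ \ E.D, ∀ q ∈ O₂ \ E.D, ∀ s ∈ O₂ \ E.D, Dya p → Dya q → Dya s →
      Cn (O \ E.D) p q ∨ Cn (O \ E.D) q s ∨ Cn (O \ E.D) p s := by
    intro p hp q hq s hs dp dq ds
    have hac : ∀ p ∈ O₂ \ E.D, Dya p → Bd E.D (pc p) := fun p hp dp =>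
      E.D_acyc h _ ((pc_zc (U := E.Dᶜ) dp hp.2).mono (by simp))
    obtain ⟨ap, ap1, ap2, ap3⟩ := hac p hp dp
    obtain ⟨aq, aq1, aq2, aq3⟩ := hac q hq dq
    obtain ⟨as, as1, as2, as3⟩ := hac s hs ds
    obtain ⟨g, g1, g2, g3⟩ := Jn_ball dp dq hp.1 hq.1
    obtain ⟨k, k1, k2, k3⟩ := Jn_ball dq ds hq.1 hs.1
    have hOO : Oᶜ ⊆ O₂ᶜ := Set.compl_subset_compl.2 hO₂O
    have z1 : Zc A' ((ap + aq) + g) := by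
      refine ⟨(ap1.add aq1).add g1, ?_, ((ap2.add aq2).mono hA'D).add (g2.mono hO₂A)⟩
      filter_upwards [ap3, aq3, g3] with N e1 e2 e3
      simp only [Pi.add_apply, map_add, e1, e2, e3]; exact ch_add_self _
    have z2 : Zc A' ((aq + as) + k) := by
      refine ⟨(aq1.add as1).add k1, ?_, ((aq2.add as2).mono hA'D).add (k2.mono hO₂A)⟩
      filter_upwards [aq3, as3, k3] with N e1 e2 e3
      simp only [Pi.add_apply, map_add, e1, e2, e3]; exact ch_add_self _
    rcases rank_le hadm Finset.univ _ _ z1 z2 with hb | hb | hb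
    · exact Or.inl (b_core E.D_compact hO hOb hsub dp ⟨hO₂O hp.1, hp.2⟩ (ap2.add aq2)
        (g2.mono hOO) g3 hb)
    · exact Or.inr (Or.inl (b_core E.D_compact hO hOb hsub dq ⟨hO₂O hq.1, hq.2⟩ (aq2.add as2)
        (k2.mono hOO) k3 hb))
    · refine Or.inr (Or.inr (b_core E.D_compact hO hOb hsub dp ⟨hO₂O hp.1, hp.2⟩
        (a := (ap + aq) + (aq + as)) (g := g + k)
        ((ap2.add aq2).add (aq2.add as2)) ((g2.add k2).mono hOO) ?_ ?_))
      · filter_upwards [g3, k3] with N e1 e2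
        simp only [Pi.add_apply, map_add] at *
        rw [e1, e2, add_assoc, ← add_assoc (pc q N), ch_add_self, zero_add]
      · rwa [add_add_add_comm]
  have near : ∀ p ∈ O₂ \ E.D, ∃ p' ∈ O₂ \ E.D, Dya p' ∧ Cn (O \ E.D) p p' := by
    intro p hp
    obtain ⟨ε, hε, hb⟩ := Metric.isOpen_iff.1 (Metric.isOpen_ball.sdiff E.D_compact.isClosed) p hp
    obtain ⟨p', N, hN, hp'⟩ := exists_dy p hε
    exact ⟨p', hb hp', ⟨N, hN⟩, Metric.ball p ε, hb.trans (Set.sdiff_subset_sdiff_left hO₂O),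
      (convex_ball p ε).isPreconnected, Metric.mem_ball_self hε, hp'⟩
  intro p hp q hq s hs
  obtain ⟨p', hp', dp, cp⟩ := near p hp
  obtain ⟨q', hq', dq, cq⟩ := near q hq
  obtain ⟨s', hs', ds, cs⟩ := near s hs
  rcases key p' hp' q' hq' s' hs' dp dq ds with hb | hb | hb
  · exact Or.inl ((cp.trans hb).trans cq.symm)
  · exact Or.inr (Or.inl ((cq.trans hb).trans cs.symm))
  · exact Or.inr (Or.inr ((cp.trans hb).trans cs.symm))

/-- remove the zero-cells -/
noncomputable def zap (c : Ch n) : Ch n := rs (fun a => ¬ ∀ i, Even (a i)) c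

theorem zap_bd (c : Ch n) : bd (zap c) = bd c := by
  conv_rhs => rw [rs_add_not (fun a : Fin n → ℤ => ¬ ∀ i, Even (a i)) c]
  have : bd (rs (fun a : Fin n → ℤ => ¬ ¬ ∀ i, Even (a i)) c) = 0 :=
    bd_zero_cells fun a ha => not_not.1 (rs_ne ha).1
  rw [map_add, this, add_zero]; rfl

theorem zap_sd (c : Ch n) : zap (sd c) = sd (zap c) := by
  funext b
  have hP : (∀ i, Even (par (b i))) ↔ ∀ i, Even (b i) := by
    apply forall_congr'; intro i
    rw [Int.even_iff, Int.even_iff, par]; omega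
  rw [sd_apply]
  simp only [zap]
  by_cases h : ∀ i, Even (b i)
  · rw [rs_apply_neg (by simpa using h), rs_apply_neg (by simpa using hP.2 h), ite_self]
  · rw [rs_apply_pos h, rs_apply_pos (fun h' => h (hP.1 h')), sd_apply]

theorem aug_zero {c : Ch n} (h : ∀ v : Fin n → ℤ, c (fun i => 2 * v i) = 0) : aug c = 0 := by
  unfold aug; simp [h]

theorem zap_dbl (c : Ch n) (v : Fin n → ℤ) : zap c (fun i => 2 * v i) = 0 := by
  apply rs_apply_neg; simp

theorem hm_dbl {c : Ch n} (h : Hm 1 c) (v : Fin n → ℤ) : c (fun i => 2 * v i) = 0 := by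
  by_contra h0
  have := h _ h0
  rw [Finset.filter_false_of_mem (fun i _ => by simp), Finset.card_empty] at this
  exact zero_ne_one this

theorem hm0 {c : Ch n} (h : Hm 0 c) : ∀ a, c a ≠ 0 → ∀ i, Even (a i) := by
  intro a ha i
  have := h a ha
  rw [Finset.card_eq_zero, Finset.filter_eq_empty_iff] at this
  exact Int.not_odd_iff_even.1 (this (Finset.mem_univ i))

/-- A zero-chain with vanishing augmentation bounds if any two of its points do. -/
theorem zero_chain {U W : Set (Fin n → ℝ)} (hW : ∀ p ∈ W, ∀ q ∈ W, Dya p → Dya q → Jn U p q)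
    {N : ℕ} {z : Sq n} (hz : ∀ M ≥ N, z (M + 1) = sd (z M)) (hfin : (Function.support (z N)).Finite)
    (h0 : ∀ a, z N a ≠ 0 → ∀ i, Even (a i)) (hWz : Avoids N (z N) Wᶜ) (haug : aug (z N) = 0) :
    Bd Uᶜ z := by
  have h2 : (0 : ℝ) < 2 ^ N := by positivity
  let x : (Fin n → ℤ) → (Fin n → ℝ) := fun a i => ((a i / 2 : ℤ) : ℝ) / 2 ^ N
  have hxN : ∀ a i, x a i * 2 ^ N = ((a i / 2 : ℤ) : ℝ) := fun a i => div_mul_cancel₀ _ h2.ne'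
  have hdy : ∀ a, Dy N (x a) := fun a i => ⟨a i / 2, hxN a i⟩
  have hxW : ∀ a, z N a ≠ 0 → x a ∈ W := by
    intro a ha
    have := Set.disjoint_compl_right_iff_subset.1 (hWz a ha)
    apply this
    intro i
    rw [hxN]
    exact ⟨le_rfl, by exact_mod_cast (by omega : a i / 2 ≤ (a i + 1) / 2)⟩
  have hpc : ∀ a, (∀ i, Even (a i)) → ∀ b, pc (x a) N b = if b = a then 1 else 0 := by
    intro a ha b
    simp only [pc]
    congr 1
    apply propext
    constructor
    · intro h
      funext i
      have h3 := (h i).2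
      rw [hxN] at h3
      have h4 : b i = 2 * (a i / 2) := by exact_mod_cast h3
      have := Int.even_iff.1 (ha i)
      omega
    · rintro rfl i
      refine ⟨ha i, ?_⟩
      rw [hxN]
      have := Int.even_iff.1 (ha i)
      exact_mod_cast (by omega : b i = 2 * (b i / 2))
  set T := hfin.toFinset with hT
  have hTm : ∀ a, a ∈ T ↔ z N a ≠ 0 := fun a => by simp [hT]
  -- z is the sum of its points
  have hsum : z N = ∑ a ∈ T, pc (x a) N := by
    funext b
    rw [Finset.sum_apply, Finset.sum_congr rfl (fun a ha => hpc a (h0 a ((hTm a).1 ha)) b)]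
    rw [Finset.sum_ite_eq]
    by_cases hb : z N b = 0
    · rw [if_neg (by rw [hTm]; simpa using hb), hb]
    · rw [if_pos ((hTm b).2 hb)]
      exact (zmod2_cases _).resolve_left hb
  have hcard : (T.card : ZMod 2) = 0 := by
    have := (aug_sum T (fun a => pc (x a) N) (fun a => pc_supp _ _)).1
    rw [← hsum, haug, Finset.sum_congr rfl (fun a _ => pc_aug (hdy a))] at this
    simpa using this.symm
  by_cases hne : T.Nonempty
  swap
  · rw [Finset.not_nonempty_iff_eq_empty] at hne
    refine Bd_of_level hz 0 ?_ (fun a ha => absurd rfl ha)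
    rw [hsum, hne]; simp
  obtain ⟨a₀, ha₀⟩ := hne
  have ind : ∀ S ⊆ T, Bd Uᶜ (fun M => ∑ a ∈ S, pc (x a) M + (S.card : ZMod 2) • pc (x a₀) M) := by
    intro S
    induction S using Finset.induction_on with
    | empty =>
      intro _
      refine ⟨fun _ => 0, Eventually.of_forall fun _ => by simp,
        Eventually.of_forall fun _ a ha => absurd rfl ha, Eventually.of_forall fun _ => by simp⟩
    | insert b S hb ih =>
      intro hS
      have h1 := ih ((Finset.subset_insert _ _).trans hS)
      have h3 := hW (x b) (hxW b ((hTm b).1 (hS (Finset.mem_insert_self _ _)))) (x a₀)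
        (hxW a₀ ((hTm a₀).1 ha₀)) ⟨N, hdy _⟩ ⟨N, hdy _⟩
      refine (h3.add h1).congr (Eventually.of_forall fun M => ?_)
      simp only [Pi.add_apply]
      rw [Finset.sum_insert hb, Finset.card_insert_of_notMem hb, Nat.cast_succ, add_smul, one_smul]
      abel
  refine (ind T le_rfl).congr ?_
  simp only [hcard, zero_smul, add_zero]
  refine eventually_atTop.2 ⟨N, eq_of_level ?_ hz hsum.symm⟩
  intro M hM
  rw [map_sum]
  exact Finset.sum_congr rfl fun a _ => pc_sd ((hdy a).le hM)

theorem partA {E : Emb m (m + 1)} {t} (h : E.Int t) {c : Fin (m + 1) → ℝ} {R : ℝ}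
    (hF : Disjoint (Metric.ball c R) (E.φ '' Pb E.A E.B E.A E.B Finset.univ))
    (htO : E.φ t ∈ Metric.ball c R) {W : Set (Fin (m + 1) → ℝ)} (hW : IsOpen W) (htW : E.φ t ∈ W) :
    ∃ p ∈ W \ E.D, ∃ q ∈ W \ E.D, ¬ Cn (Metric.ball c R \ E.D) p q := by
  by_contra hcon
  push Not at hcon
  have hR : 0 < R := Metric.pos_of_mem_ball htO
  set O := Metric.ball c R with hOdef
  have hO : IsOpen O := Metric.isOpen_ball
  set W' := W ∩ O with hW'
  obtain ⟨α, β, hadm, htn, hsub⟩ := slab_choice h (hW.inter hO) ⟨htW, htO⟩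
  set F := E.φ '' Pb E.A E.B E.A E.B Finset.univ with hFdef
  have hFD : F ⊆ E.D := Set.image_mono (Pb_sub _ _ _ _ _)
  have hFO : F ⊆ Oᶜ := fun x hx hx' => Set.disjoint_left.1 hF hx' hx
  obtain ⟨z, hz, hz1, hzb⟩ := exists_class hadm h.adm Finset.univ 1 (by simp [add_comm])
  obtain ⟨z1, z2, i1, i2, v1, v2, hzz, hh⟩ := split hz.1 E.D_compact (hW.inter hO).isClosed_compl
    (hz.3.mono hsub) 1
  obtain ⟨hh1, hh2⟩ := hh hz1
  have heq : ∀ᶠ N in atTop, bd (z1 N) = bd (z2 N) := by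
    filter_upwards [hzz, hz.2] with N e1 e2
    rw [e1, map_add] at e2
    have := sq_cancel _ _ _ e2
    rw [this, zero_add]
  have hUW : (W' \ E.D)ᶜ = E.D ∪ W'ᶜ := by
    ext x; simp only [Set.mem_compl_iff, Set.mem_sdiff, Set.mem_union]; tauto
  have hU : IsOpen (O \ E.D) := hO.sdiff E.D_compact.isClosed
  have hWb : Bornology.IsBounded W' := Metric.isBounded_ball.subset Set.inter_subset_right
  have hBd : Bd (O \ E.D)ᶜ (fun N => bd (z1 N)) := by
    obtain ⟨N, hN⟩ := eventually_atTop.1 (i1.and (v1.and (v2.and (hh1.and heq))))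
    obtain ⟨-, k1, k2, k3, k4⟩ := hN N le_rfl
    refine zero_chain (W := W' \ E.D) ?_ (N := N) ?_ ?_ (hm0 (Hm.bd k3)) ?_ ?_
    · intro p hp q hq dp dq
      obtain ⟨T, hTU, hT, hpT, hqT⟩ := hcon p ⟨hp.1.1, hp.2⟩ q ⟨hq.1.1, hq.2⟩
      exact join hU hT hTU dp dq hpT hqT
    · intro M hM
      rw [(hN M hM).1, bd_sd]
    · simp only [k4]
      exact finite_support_bd (fin_supp hWb k2)
    · rw [hUW]
      refine k1.bd.union ?_
      simp only [k4]
      exact k2.bd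
    · simp only [k4]
      exact aug_bd (fin_supp hWb k2)
  obtain ⟨a, a1, a2, a3⟩ := hBd
  have y1 : IsC (fun N => zap (a N)) := by
    filter_upwards [a1] with N e
    rw [e, zap_sd]
  have y2 : Av (O \ E.D)ᶜ (fun N => zap (a N)) := by
    filter_upwards [a2] with N e using e.rs _
  have y3 : ∀ᶠ N in atTop, bd (zap (a N)) = bd (z1 N) := by
    filter_upwards [a3] with N e
    rw [zap_bd, e]
  have b1 : Bd E.D (z1 + fun N => zap (a N)) := by
    apply E.D_acyc h _ ⟨i1.add y1, ?_, v1.add (y2.mono fun x hx hx' => hx'.2 hx)⟩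
    filter_upwards [y3] with N e
    simp only [Pi.add_apply, map_add, e]; exact ch_add_self _
  have b2 : Bd Oᶜ (z2 + fun N => zap (a N)) := by
    apply box_bd hR ⟨i2.add y1, ?_, (v2.mono ?_).add (y2.mono fun x hx hx' => hx hx'.1)⟩
    · filter_upwards [hh2] with N e
      apply aug_zero
      intro v
      simp only [Pi.add_apply]
      rw [hm_dbl e, zap_dbl, add_zero]
    · filter_upwards [y3, heq] with N e e'
      simp only [Pi.add_apply, map_add, e, e']; exact ch_add_self _
    · exact Set.compl_subset_compl.2 Set.inter_subset_right
  apply hzb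
  refine ((b1.mono hFD).add (b2.mono hFO)).congr ?_
  filter_upwards [hzz] with N e
  simp only [Pi.add_apply, e]
  rw [add_add_add_comm, ch_add_self, add_zero]

end LJB


namespace LJB
open Filter Topology

theorem Cn.comp_eq {X : Type*} [TopologicalSpace X] {U : Set X} {p q : X} (h : Cn U p q) :
    connectedComponentIn U p = connectedComponentIn U q := by
  obtain ⟨T, hT, h1, h2, h3⟩ := h
  exact connectedComponentIn_eq (h1.subset_connectedComponentIn h2 hT h3)

theorem Cn.mono {X : Type*} [TopologicalSpace X] {U V : Set X} {p q : X} (h : Cn U p q)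
    (hUV : U ⊆ V) : Cn V p q := by
  obtain ⟨T, hT, h1, h2, h3⟩ := h
  exact ⟨T, hT.trans hUV, h1, h2, h3⟩

theorem Cn.image {X Y : Type*} [TopologicalSpace X] [TopologicalSpace Y] {f : X → Y}
    (hf : Continuous f) {U : Set X} {p q : X} (h : Cn U p q) : Cn (f '' U) (f p) (f q) := by
  obtain ⟨T, hT, h1, h2, h3⟩ := h
  exact ⟨f '' T, Set.image_mono hT, h1.image f hf.continuousOn, ⟨p, h2, rfl⟩, ⟨q, h3, rfl⟩⟩

theorem final_top {Y : Type*} [TopologicalSpace Y] {B₁ B₂ S : Set Y} {x : Y} (hx : x ∈ B₂)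
    (hxS : x ∈ S) (hB : B₂ ⊆ B₁) (hB₂ : IsOpen B₂)
    (hb : ∀ p ∈ B₂ \ S, ∀ q ∈ B₂ \ S, ∀ s ∈ B₂ \ S,
      Cn (B₁ \ S) p q ∨ Cn (B₁ \ S) q s ∨ Cn (B₁ \ S) p s)
    (ha : ∀ y ∈ B₂ ∩ S, ∀ W, IsOpen W → y ∈ W → ∃ p ∈ (W ∩ B₂) \ S, ∃ q ∈ (W ∩ B₂) \ S,
      ¬ Cn (B₁ \ S) p q) :
    (∀ z ∈ B₁ \ S, connectedComponentIn (B₁ \ S) z ∩ B₂ = ∅ ∨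
        B₂ ∩ S ⊆ closure (connectedComponentIn (B₁ \ S) z)) ∧
      ∃ C₁ C₂ : Set Y, C₁ ≠ C₂ ∧ sepComponents S B₁ B₂ = {C₁, C₂} := by
  have h1 : ∀ z ∈ B₁ \ S, connectedComponentIn (B₁ \ S) z ∩ B₂ = ∅ ∨
        B₂ ∩ S ⊆ closure (connectedComponentIn (B₁ \ S) z) := by
    intro z hz
    rcases Set.eq_empty_or_nonempty (connectedComponentIn (B₁ \ S) z ∩ B₂) with h | ⟨q, hq, hq2⟩
    · exact Or.inl h
    right
    have hqS : q ∈ B₂ \ S := ⟨hq2, (connectedComponentIn_subset _ _ hq).2⟩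
    have hqU : q ∈ B₁ \ S := ⟨hB hq2, hqS.2⟩
    rw [connectedComponentIn_eq hq]
    intro y hy
    rw [mem_closure_iff]
    intro W hW hyW
    obtain ⟨p, hp, p', hp', hn⟩ := ha y hy W hW hyW
    have hmem : ∀ p ∈ (W ∩ B₂) \ S, Cn (B₁ \ S) q p →
        (W ∩ connectedComponentIn (B₁ \ S) q).Nonempty := by
      intro p hp h
      refine ⟨p, hp.1.1, ?_⟩
      rw [h.comp_eq]
      exact mem_connectedComponentIn ⟨hB hp.1.2, hp.2⟩
    rcases hb q hqS p ⟨hp.1.2, hp.2⟩ p' ⟨hp'.1.2, hp'.2⟩ with h | h | h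
    · exact hmem p hp h
    · exact absurd h hn
    · exact hmem p' hp' h
  refine ⟨h1, ?_⟩
  obtain ⟨p, hp, q, hq, hn⟩ := ha x ⟨hx, hxS⟩ Set.univ isOpen_univ (Set.mem_univ _)
  have hp2 : p ∈ B₂ \ S := ⟨hp.1.2, hp.2⟩
  have hq2 : q ∈ B₂ \ S := ⟨hq.1.2, hq.2⟩
  have hsep : ∀ p ∈ B₂ \ S, connectedComponentIn (B₁ \ S) p ∈ sepComponents S B₁ B₂ := by
    intro p hp
    have hpU : p ∈ B₁ \ S := ⟨hB hp.1, hp.2⟩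
    refine ⟨⟨p, hpU, rfl⟩, (h1 p hpU).resolve_left ?_⟩
    exact Set.Nonempty.ne_empty ⟨p, mem_connectedComponentIn hpU, hp.1⟩
  refine ⟨connectedComponentIn (B₁ \ S) p, connectedComponentIn (B₁ \ S) q, ?_, ?_⟩
  · intro h
    apply hn
    refine ⟨_, connectedComponentIn_subset _ p, isPreconnected_connectedComponentIn,
      mem_connectedComponentIn ⟨hB hp2.1, hp2.2⟩, ?_⟩
    rw [h]
    exact mem_connectedComponentIn ⟨hB hq2.1, hq2.2⟩
  · ext C
    simp only [Set.mem_insert_iff, Set.mem_singleton_iff]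
    constructor
    · rintro ⟨⟨z, hz, rfl⟩, hcl⟩
      obtain ⟨s, hs2, hsC⟩ := mem_closure_iff.1 (hcl ⟨hx, hxS⟩) B₂ hB₂ hx
      have hsS : s ∈ B₂ \ S := ⟨hs2, (connectedComponentIn_subset _ _ hsC).2⟩
      rw [connectedComponentIn_eq hsC]
      rcases hb p hp2 q hq2 s hsS with h | h | h
      · exact absurd h hn
      · exact Or.inr h.comp_eq.symm
      · exact Or.inl h.comp_eq.symm
    · rintro (rfl | rfl)
      · exact hsep p hp2
      · exact hsep q hq2

theorem chart {Y Z : Type*} [TopologicalSpace Y] [TopologicalSpace Z] {m n : ℕ}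
    (ψ : Y ≃ₜ (Fin n → ℝ)) (χ : Z ≃ₜ (Fin m → ℝ)) {U S : Set Y} {x : Y} (hU : IsOpen U) (hxU : x ∈ U)
    (hxS : x ∈ S) {V : Set Z} (hV : IsOpen V) (e : (U ∩ S : Set Y) ≃ₜ V) :
    ∃ (E : Emb m n) (t : Fin m → ℝ), E.Int t ∧ E.φ t = ψ x ∧ E.D ⊆ ψ '' S ∧
      ∃ G : Set Y, IsOpen G ∧ x ∈ G ∧ ∀ y ∈ G, y ∈ S → ∃ t', E.Int t' ∧ E.φ t' = ψ y := by
  classical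
  set t : Fin m → ℝ := χ (e ⟨x, hxU, hxS⟩) with ht
  have hVo : IsOpen (χ.symm ⁻¹' V) := hV.preimage χ.symm.continuous
  have htV : t ∈ χ.symm ⁻¹' V := by
    simp [ht]
  obtain ⟨ε, hε, hb⟩ := Metric.isOpen_iff.1 hVo t htV
  let A : Fin m → ℝ := fun i => t i - ε / 2
  let B : Fin m → ℝ := fun i => t i + ε / 2
  have hAB : Set.Icc A B ⊆ χ.symm ⁻¹' V := by
    intro s hs
    apply hb
    rw [Metric.mem_ball, dist_pi_lt_iff hε]
    intro i
    have h1 := hs.1 i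
    have h2 := hs.2 i
    simp only [A, B] at h1 h2
    rw [Real.dist_eq, abs_lt]
    constructor <;> linarith
  let φ : (Fin m → ℝ) → (Fin n → ℝ) := fun s =>
    if h : χ.symm s ∈ V then ψ (e.symm ⟨χ.symm s, h⟩).1 else 0
  have hφ : ∀ s (h : χ.symm s ∈ V), φ s = ψ (e.symm ⟨χ.symm s, h⟩).1 := fun s h => dif_pos h
  have hφe : ∀ y (h : y ∈ U ∩ S), φ (χ (e ⟨y, h⟩)) = ψ y := by
    intro y h
    have hm : χ.symm (χ (e ⟨y, h⟩)) ∈ V := by simp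
    rw [hφ _ hm]
    simp
  have hcont : ContinuousOn φ (Set.Icc A B) := by
    apply ContinuousOn.mono _ hAB
    rw [continuousOn_iff_continuous_domRestrict]
    have : (χ.symm ⁻¹' V).domRestrict φ = fun s => ψ (e.symm ⟨χ.symm s.1, s.2⟩).1 := by
      funext s
      exact hφ s.1 s.2
    rw [this]
    fun_prop
  have hinj : Set.InjOn φ (Set.Icc A B) := by
    intro s hs s' hs' h
    rw [hφ s (hAB hs), hφ s' (hAB hs')] at h
    have := e.symm.injective (Subtype.ext (ψ.injective h))
    exact χ.symm.injective (congrArg Subtype.val this)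
  refine ⟨⟨φ, A, B, hcont, hinj⟩, t, ?_, hφe x _, ?_, ?_⟩
  · intro i
    simp only [A, B]
    constructor <;> linarith
  · rintro _ ⟨s, hs, rfl⟩
    refine ⟨(e.symm ⟨χ.symm s, hAB hs⟩).1, (e.symm ⟨χ.symm s, hAB hs⟩).2.2, ?_⟩
    exact (hφ s (hAB hs)).symm
  · have ho : IsOpen {s : Fin m → ℝ | ∀ i, A i < s i ∧ s i < B i} := by
      have : {s : Fin m → ℝ | ∀ i, A i < s i ∧ s i < B i} = Set.pi Set.univ fun i => Set.Ioo (A i) (B i) := by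
        ext s; simp
      rw [this]
      exact isOpen_set_pi Set.finite_univ fun i _ => isOpen_Ioo
    have ho2 : IsOpen ((fun y : (U ∩ S : Set Y) => χ (e y)) ⁻¹'
        {s : Fin m → ℝ | ∀ i, A i < s i ∧ s i < B i}) := ho.preimage (by fun_prop)
    obtain ⟨G, hG, hGe⟩ := isOpen_induced_iff.1 ho2
    have hGm : ∀ y (h : y ∈ U ∩ S), y ∈ G ↔ ∀ i, A i < χ (e ⟨y, h⟩) i ∧ χ (e ⟨y, h⟩) i < B i := by
      intro y h
      have := Set.ext_iff.1 hGe ⟨y, h⟩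
      exact this
    refine ⟨G ∩ U, hG.inter hU, ⟨?_, hxU⟩, ?_⟩
    · rw [hGm x ⟨hxU, hxS⟩]
      intro i
      simp only [A, B, ← ht]
      constructor <;> linarith
    · rintro y ⟨hyG, hyU⟩ hyS
      exact ⟨χ (e ⟨y, hyU, hyS⟩), (hGm y ⟨hyU, hyS⟩).1 hyG, hφe y _⟩

theorem main_aux (n m : ℕ) (hnm : n = m + 1)
    (S : Set (EuclideanSpace ℝ (Fin n)))
    (x : EuclideanSpace ℝ (Fin n)) (hx : x ∈ S)
    (hloc : ∃ U : Set (EuclideanSpace ℝ (Fin n)), IsOpen U ∧ x ∈ U ∧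
      ∃ V : Set (EuclideanSpace ℝ (Fin m)), IsOpen V ∧
        Nonempty (((U ∩ S : Set (EuclideanSpace ℝ (Fin n))) : Type _) ≃ₜ (V : Type _))) :
    ∃ r₁ r₂ : ℝ, 0 < r₂ ∧ r₂ ≤ r₁ ∧
      (∀ z ∈ Metric.ball x r₁ \ S,
        connectedComponentIn (Metric.ball x r₁ \ S) z ∩ Metric.ball x r₂ = ∅ ∨
        Metric.ball x r₂ ∩ S ⊆ closure (connectedComponentIn (Metric.ball x r₁ \ S) z)) ∧
      ∃ C₁ C₂ : Set (EuclideanSpace ℝ (Fin n)), C₁ ≠ C₂ ∧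
        sepComponents S (Metric.ball x r₁) (Metric.ball x r₂) = {C₁, C₂} := by
  subst hnm
  obtain ⟨U, hU, hxU, V, hV, ⟨e⟩⟩ := hloc
  let ψ : EuclideanSpace ℝ (Fin (m + 1)) ≃ₜ (Fin (m + 1) → ℝ) :=
    (EuclideanSpace.equiv (Fin (m + 1)) ℝ).toHomeomorph
  let χ : EuclideanSpace ℝ (Fin m) ≃ₜ (Fin m → ℝ) := (EuclideanSpace.equiv (Fin m) ℝ).toHomeomorph
  obtain ⟨E, t, ht, htx, hDS, G, hG, hxG, hGS⟩ := chart ψ χ hU hxU hx hV e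
  set F := E.φ '' Pb E.A E.B E.A E.B Finset.univ with hF
  have hFc : IsClosed F := (E.compact (Pb_sub _ _ _ _ _) (Pb_closed _ _ _ _ _)).isClosed
  have hxF : ψ x ∉ F := by
    rintro ⟨s, hs, hse⟩
    have : s = t := E.inj hs.1 ht.mem (hse.trans htx.symm)
    subst this
    obtain ⟨-, i, -, hi⟩ := hs
    have := ht i
    rcases hi with hi | hi <;> linarith
  obtain ⟨R, hR, hball⟩ := Metric.isOpen_iff.1 ((ψ.isOpenMap _ hG).inter hFc.isOpen_compl) (ψ x)
    ⟨⟨x, hxG, rfl⟩, hxF⟩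
  obtain ⟨r₁, hr₁, hr₁b⟩ := Metric.isOpen_iff.1 ((Metric.isOpen_ball (x := ψ x) (ε := R)).preimage
    ψ.continuous) x (Metric.mem_ball_self hR)
  set B₁ := Metric.ball x r₁ with hB₁
  have hOb : ψ '' B₁ ⊆ Metric.ball (ψ x) R := Set.image_subset_iff.2 hr₁b
  have hDiff : ∀ y ∈ B₁, y ∈ S → ∃ t', E.Int t' ∧ E.φ t' = ψ y := by
    intro y hy hyS
    obtain ⟨⟨y', hy', he⟩, -⟩ := hball (hr₁b hy)
    rw [ψ.injective he] at hy'
    exact hGS y hy' hyS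
  have hDiff2 : ∀ y ∈ B₁, (ψ y ∈ E.D ↔ y ∈ S) := by
    intro y hy
    constructor
    · intro h
      obtain ⟨y', hy', he⟩ := hDS h
      rwa [← ψ.injective he]
    · intro h
      obtain ⟨t', h1, h2⟩ := hDiff y hy h
      exact ⟨t', h1.mem, h2⟩
  obtain ⟨r, hr, -, hrb⟩ := partB ht (O := ψ '' B₁) (ψ.isOpenMap _ Metric.isOpen_ball)
    (Metric.isBounded_ball.subset hOb) (by rw [htx]; exact ⟨x, Metric.mem_ball_self hr₁, rfl⟩)
  rw [htx] at hrb
  obtain ⟨r₂, hr₂, hr₂b⟩ := Metric.isOpen_iff.1 ((Metric.isOpen_ball (x := ψ x) (ε := r)).preimage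
    ψ.continuous) x (Metric.mem_ball_self hr)
  refine ⟨r₁, min r₁ r₂, lt_min hr₁ hr₂, min_le_left _ _, ?_⟩
  have hB : Metric.ball x (min r₁ r₂) ⊆ B₁ := Metric.ball_subset_ball (min_le_left _ _)
  have hB' : ∀ y ∈ Metric.ball x (min r₁ r₂) \ S, ψ y ∈ Metric.ball (ψ x) r \ E.D := by
    rintro y ⟨hy, hyS⟩
    exact ⟨hr₂b (Metric.ball_subset_ball (min_le_right _ _) hy), fun h => hyS ((hDiff2 y (hB hy)).1 h)⟩
  have hback : ∀ p q, Cn (ψ '' B₁ \ E.D) (ψ p) (ψ q) → Cn (B₁ \ S) p q := by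
    intro p q h
    have := h.image ψ.symm.continuous
    simp only [Homeomorph.symm_apply_apply] at this
    refine this.mono ?_
    rintro _ ⟨_, ⟨⟨y, hy, rfl⟩, hyD⟩, rfl⟩
    rw [ψ.symm_apply_apply]
    exact ⟨hy, fun h => hyD ((hDiff2 y hy).2 h)⟩
  apply final_top (Metric.mem_ball_self (lt_min hr₁ hr₂)) hx hB Metric.isOpen_ball
  · intro p hp q hq s hs
    rcases hrb _ (hB' p hp) _ (hB' q hq) _ (hB' s hs) with h | h | h
    · exact Or.inl (hback _ _ h)
    · exact Or.inr (Or.inl (hback _ _ h))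
    · exact Or.inr (Or.inr (hback _ _ h))
  · rintro y ⟨hy, hyS⟩ W hW hyW
    obtain ⟨t', h1, h2⟩ := hDiff y (hB hy) hyS
    obtain ⟨p', ⟨⟨p, hp, rfl⟩, hpD⟩, q', ⟨⟨q, hq, rfl⟩, hqD⟩, hn⟩ := partA h1 (c := ψ x) (R := R)
      (Set.disjoint_left.2 fun z hz hz' => (hball hz).2 hz') (by rw [h2]; exact hr₁b (hB hy))
      (W := ψ '' (W ∩ Metric.ball x (min r₁ r₂))) (ψ.isOpenMap _ (hW.inter Metric.isOpen_ball))
      (by rw [h2]; exact ⟨y, ⟨hyW, hy⟩, rfl⟩)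
    refine ⟨p, ⟨hp, fun h => hpD ((hDiff2 p (hB hp.2)).2 h)⟩, q,
      ⟨hq, fun h => hqD ((hDiff2 q (hB hq.2)).2 h)⟩, fun h => hn ?_⟩
    refine (h.image ψ.continuous).mono ?_
    rintro _ ⟨y, ⟨hy, hyS⟩, rfl⟩
    exact ⟨hr₁b hy, fun h => hyS ((hDiff2 y hy).1 h)⟩

end LJB

/-- **Local Jordan–Brouwer separation theorem.** Let `S` be a closed subset of `ℝⁿ` (`n > 1`)
containing a point `x` such that some neighbourhood of `x` in `S` is homeomorphic to an open
subset of `ℝ^{n-1}`. Then there are open balls `B₂ ⊆ B₁` centered at `x` such that every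
connected component `C` of `B₁ \ S` is either disjoint from `B₂` or satisfies
`B₂ ∩ S ⊆ closure C`, and exactly two connected components satisfy the latter condition. -/
theorem local_jordan_brouwer_separation
    (n : ℕ) (hn : 1 < n)
    (S : Set (EuclideanSpace ℝ (Fin n))) (hS : IsClosed S)
    (x : EuclideanSpace ℝ (Fin n)) (hx : x ∈ S)
    (hloc : ∃ U : Set (EuclideanSpace ℝ (Fin n)), IsOpen U ∧ x ∈ U ∧
      ∃ V : Set (EuclideanSpace ℝ (Fin (n - 1))), IsOpen V ∧
        Nonempty (((U ∩ S : Set (EuclideanSpace ℝ (Fin n))) : Type _) ≃ₜ (V : Type _))) :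
    ∃ r₁ r₂ : ℝ, 0 < r₂ ∧ r₂ ≤ r₁ ∧
      (∀ z ∈ Metric.ball x r₁ \ S,
        connectedComponentIn (Metric.ball x r₁ \ S) z ∩ Metric.ball x r₂ = ∅ ∨
        Metric.ball x r₂ ∩ S ⊆ closure (connectedComponentIn (Metric.ball x r₁ \ S) z)) ∧
      ∃ C₁ C₂ : Set (EuclideanSpace ℝ (Fin n)), C₁ ≠ C₂ ∧
        sepComponents S (Metric.ball x r₁) (Metric.ball x r₂) = {C₁, C₂} := by
  exact LJB.main_aux n (n - 1) (by omega) S x hx hloc
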